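/- Let φ : [-1,1]² → ℝ be a C² function with nonzero Hessian determinant, in the sense that inf_{(x,y)∈[-1,1]²} |φ_xx(x,y) φ_yy(x,y) − φ_xy(x,y)²| > 0. Then for every ε > 0 there exists a constant C_ε > 0, depending only on φ and ε, such that for every positive integer N and every sequence of complex numbers (a_n)_{n=-N}^{N}, one has ‖∑_{n=-N}^{N} a_n e(n x + n² y + n³ φ(x,y))‖_{L⁶([-1,1]²)} ≤ C_ε N^ε (∑_{n=-N}^{N} |a_n|²)^{1/2}. -/

import Mathlib

open MeasureTheory

/-- `e z = e^{2πiz}`. -/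
noncomputable def e (t : ℝ) : ℂ := Complex.exp (2 * Real.pi * Complex.I * t)

/-- The closed square `[-1,1]²`. -/
def Sq : Set (ℝ × ℝ) := Set.Icc (-1) 1 ×ˢ Set.Icc (-1) 1

/-- Finite sets of integers of small diameter are small. -/
lemma card_le_of_diam_le (s : Finset ℤ) (d : ℝ) (hd : 0 ≤ d)
    (h : ∀ x ∈ s, ∀ y ∈ s, ((y - x : ℤ) : ℝ) ≤ d) : (s.card : ℝ) ≤ d + 1 := by
  rcases s.eq_empty_or_nonempty with rfl | hs
  · simp; linarith
  have h1 : s ⊆ Finset.Icc (s.min' hs) (s.max' hs) := fun x hx =>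
    Finset.mem_Icc.2 ⟨s.min'_le x hx, s.le_max' x hx⟩
  have h2 := Finset.card_le_card h1
  rw [Int.card_Icc] at h2
  have h3 : s.min' hs ≤ s.max' hs := s.min'_le _ (s.max'_mem hs)
  have h4 := h _ (s.min'_mem hs) _ (s.max'_mem hs)
  have h5 : (s.card : ℤ) ≤ s.max' hs - s.min' hs + 1 := by omega
  have h6 : (s.card : ℝ) ≤ ((s.max' hs - s.min' hs : ℤ) : ℝ) + 1 := by exact_mod_cast h5
  linarith

/-- Fibrewise bound for cardinalities. -/
lemma card_le_card_mul_of_fiber {α β : Type*} [DecidableEq β] (s : Finset α) (t : Finset β)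
    (f : α → β) (hf : ∀ x ∈ s, f x ∈ t) (B : ℝ)
    (h : ∀ b ∈ t, ((s.filter (fun x => f x = b)).card : ℝ) ≤ B) :
    (s.card : ℝ) ≤ t.card * B := by
  rw [Finset.card_eq_sum_card_fiberwise (f := f) (t := t) hf]
  push_cast
  calc _ ≤ ∑ b ∈ t, B := Finset.sum_le_sum h
    _ = _ := by simp

lemma card_le_of_injOn_of_diam {α : Type*} (s : Finset α) (f : α → ℤ)
    (hf : Set.InjOn f s) (d : ℝ) (hd : 0 ≤ d)
    (h : ∀ x ∈ s, ∀ y ∈ s, ((f y - f x : ℤ) : ℝ) ≤ d) : (s.card : ℝ) ≤ d + 1 := by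
  classical
  rw [← Finset.card_image_of_injOn hf]
  refine card_le_of_diam_le _ d hd ?_
  intro x hx y hy
  obtain ⟨v, hv, rfl⟩ := Finset.mem_image.1 hx
  obtain ⟨w, hw, rfl⟩ := Finset.mem_image.1 hy
  exact h v hv w hw

/-- Pairs in a dyadic block whose square and cube sums are prescribed up to `O(M)`,
`K ≤ M ≤ K²`. -/
lemma card_pairs_le (K M : ℤ) (hK : 1 ≤ K) (hKM : K ≤ M) (hMK : M ≤ K ^ 2)
    (s : Finset (ℤ × ℤ))
    (hs : ∀ v ∈ s, K ≤ v.1 ∧ v.1 < 2 * K ∧ K ≤ v.2 ∧ v.2 < 2 * K)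
    (h2 : ∀ v ∈ s, ∀ w ∈ s, |(w.1 ^ 2 + w.2 ^ 2) - (v.1 ^ 2 + v.2 ^ 2)| ≤ 2 * M)
    (h3 : ∀ v ∈ s, ∀ w ∈ s, |(w.1 ^ 3 + w.2 ^ 3) - (v.1 ^ 3 + v.2 ^ 3)| ≤ 2 * M) :
    (s.card : ℝ) ≤ 30 * (M / K : ℝ) := by
  classical
  have hKr : (0:ℝ) < K := by exact_mod_cast (by omega : 0 < K)
  have hMKr : (1:ℝ) ≤ M / K := by
    rw [le_div_iff₀ hKr]; simpa using (by exact_mod_cast hKM : (K:ℝ) ≤ M)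
  -- the sum varies by at most `5 M / K`
  have hP' : ∀ v ∈ s, ∀ w ∈ s, (w.1 + w.2 - (v.1 + v.2)) * K ≤ 5 * M := by
    intro v hv w hw
    obtain ⟨a1, a2, a3, a4⟩ := hs v hv
    obtain ⟨b1, b2, b3, b4⟩ := hs w hw
    have e2 := abs_le.1 (h2 v hv w hw)
    have e3 := abs_le.1 (h3 v hv w hw)
    obtain ⟨x, y⟩ := v
    obtain ⟨x', y'⟩ := w
    simp only at *
    rcases le_total (x' + y') (x + y) with hle | hle
    · nlinarith
    have key : (x' + y' - (x + y)) * ((x + y) ^ 2 + (x + y) * (x' + y') + (x' + y') ^ 2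
        - 3 * (x ^ 2 + y ^ 2)) = 3 * (x' + y') * ((x' ^ 2 + y' ^ 2) - (x ^ 2 + y ^ 2))
          - 2 * ((x' ^ 3 + y' ^ 3) - (x ^ 3 + y ^ 3)) := by ring
    have lo : 6 * K ^ 2 ≤ (x + y) ^ 2 + (x + y) * (x' + y') + (x' + y') ^ 2
        - 3 * (x ^ 2 + y ^ 2) := by
      have : K ^ 2 ≤ x * y := by nlinarith
      nlinarith [mul_nonneg (by omega : 0 ≤ x + y) (sub_nonneg.2 hle),
        mul_nonneg (by omega : 0 ≤ x' + y') (sub_nonneg.2 hle)]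
    have up : 3 * (x' + y') * ((x' ^ 2 + y' ^ 2) - (x ^ 2 + y ^ 2))
          - 2 * ((x' ^ 3 + y' ^ 3) - (x ^ 3 + y ^ 3)) ≤ 28 * K * M := by
      have h1 : (x' + y') * ((x' ^ 2 + y' ^ 2) - (x ^ 2 + y ^ 2)) ≤ (4 * K) * (2 * M) := by
        calc _ ≤ (x' + y') * (2 * M) := mul_le_mul_of_nonneg_left e2.2 (by omega)
          _ ≤ _ := mul_le_mul_of_nonneg_right (by omega) (by omega)
      nlinarith
    have h5 : (x' + y' - (x + y)) * (6 * K ^ 2) ≤ 28 * K * M := by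
      calc _ ≤ _ := mul_le_mul_of_nonneg_left lo (by omega)
        _ ≤ _ := by rw [key]; exact up
    have h6 : K * ((x' + y' - (x + y)) * K * 6) ≤ K * (28 * M) := by nlinarith
    have h7 := le_of_mul_le_mul_left h6 (by omega)
    omega
  -- the difference determines the sum
  have hD : ∀ v ∈ s, ∀ w ∈ s, v.1 - v.2 = w.1 - w.2 → v.1 + v.2 ≤ w.1 + w.2 →
      v = w := by
    intro v hv w hw hd hle
    obtain ⟨a1, a2, a3, a4⟩ := hs v hv
    obtain ⟨b1, b2, b3, b4⟩ := hs w hw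
    have e3 := abs_le.1 (h3 v hv w hw)
    obtain ⟨x, y⟩ := v
    obtain ⟨x', y'⟩ := w
    simp only at *
    obtain ⟨t, ht⟩ : ∃ t, x' = x + t := ⟨x' - x, by ring⟩
    have ht' : y' = y + t := by omega
    subst ht ht'
    have ht0 : 0 ≤ t := by omega
    by_contra hne
    have ht1 : 1 ≤ t := by
      by_contra h
      have : t = 0 := by omega
      subst this; simp at hne
    have : 6 * K ^ 2 * t ≤ ((x + t) ^ 3 + (y + t) ^ 3) - (x ^ 3 + y ^ 3) := by
      have hx : K ^ 2 ≤ x ^ 2 := by nlinarith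
      have hy : K ^ 2 ≤ y ^ 2 := by nlinarith
      have h1 := mul_le_mul_of_nonneg_right hx ht0
      have h2 := mul_le_mul_of_nonneg_right hy ht0
      have h3 : 0 ≤ x * t ^ 2 := mul_nonneg (by omega) (sq_nonneg t)
      have h4 : 0 ≤ y * t ^ 2 := mul_nonneg (by omega) (sq_nonneg t)
      have h5 : 0 ≤ t ^ 3 := by positivity
      nlinarith
    nlinarith
  have hDinj : ∀ v ∈ s, ∀ w ∈ s, v.1 - v.2 = w.1 - w.2 → v = w := by
    intro v hv w hw hd
    rcases le_total (v.1 + v.2) (w.1 + w.2) with h | h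
    · exact hD v hv w hw hd h
    · exact (hD w hw v hv hd.symm h).symm
  -- given the sum, large differences are determined up to sign
  have hS : ∀ v ∈ s, ∀ w ∈ s, v.1 + v.2 = w.1 + w.2 → M < K * (v.1 - v.2) →
      v.1 - v.2 < w.1 - w.2 → False := by
    intro v hv w hw hp hl hlt
    obtain ⟨a1, a2, a3, a4⟩ := hs v hv
    have e3 := abs_le.1 (h3 v hv w hw)
    obtain ⟨x, y⟩ := v
    obtain ⟨x', y'⟩ := w
    simp only at *
    obtain ⟨t, ht⟩ : ∃ t, x' = x + t := ⟨x' - x, by ring⟩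
    have ht' : y' = y - t := by omega
    subst ht ht'
    have ht1 : 1 ≤ t := by omega
    have key : ((x + t) ^ 3 + (y - t) ^ 3) - (x ^ 3 + y ^ 3) =
      3 * (x + y) * t * (x - y + t) := by ring
    rw [key] at e3
    have h1 : 2 * K ≤ x + y := by omega
    have h0 : 0 < x - y := by nlinarith
    have h4 : K * (x - y) ≤ K * (t * (x - y + t)) := by
      apply mul_le_mul_of_nonneg_left _ (by omega); nlinarith
    have h5 : 2 * K * (t * (x - y + t)) ≤ (x + y) * (t * (x - y + t)) := by
      apply mul_le_mul_of_nonneg_right h1 (by positivity)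
    nlinarith
  have hS' : ∀ v ∈ s, ∀ w ∈ s, v.1 + v.2 = w.1 + w.2 → K * (v.1 - v.2) < - M →
      w.1 - w.2 < v.1 - v.2 → False := by
    intro v hv w hw hp hl hlt
    obtain ⟨a1, a2, a3, a4⟩ := hs v hv
    have e3 := abs_le.1 (h3 v hv w hw)
    obtain ⟨x, y⟩ := v
    obtain ⟨x', y'⟩ := w
    simp only at *
    obtain ⟨t, ht⟩ : ∃ t, x' = x - t := ⟨x - x', by ring⟩
    have ht' : y' = y + t := by omega
    subst ht ht'
    have ht1 : 1 ≤ t := by omega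
    have key : ((x - t) ^ 3 + (y + t) ^ 3) - (x ^ 3 + y ^ 3) =
      3 * (x + y) * t * (y - x + t) := by ring
    rw [key] at e3
    have h1 : 2 * K ≤ x + y := by omega
    have h0 : 0 < y - x := by nlinarith
    have h4 : K * (y - x) ≤ K * (t * (y - x + t)) := by
      apply mul_le_mul_of_nonneg_left _ (by omega); nlinarith
    have h5 : 2 * K * (t * (y - x + t)) ≤ (x + y) * (t * (y - x + t)) := by
      apply mul_le_mul_of_nonneg_right h1 (by positivity)
    nlinarith
  have hcast : ∀ z : ℤ, ∀ c : ℤ, z * K ≤ c * M → (z : ℝ) ≤ c * (M / K) := by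
    intro z c h
    rw [← mul_div_assoc, le_div_iff₀ hKr]; exact_mod_cast h
  set s1 := s.filter (fun v => M < K * (v.1 - v.2))
  set s2 := s.filter (fun v => K * (v.1 - v.2) < - M)
  set s3 := s.filter (fun v => |K * (v.1 - v.2)| ≤ M)
  have hcov : s ⊆ s1 ∪ s2 ∪ s3 := by
    intro v hv
    simp only [s1, s2, s3, Finset.mem_union, Finset.mem_filter, hv, true_and, abs_le]
    omega
  have c1 : (s1.card : ℝ) ≤ 5 * (M / K) + 1 := by
    refine card_le_of_injOn_of_diam s1 (fun v => v.1 + v.2) ?_ _ (by positivity) ?_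
    · intro v hv w hw hvw
      simp only [s1, Finset.coe_filter, Set.mem_ofPred_eq] at hv hw
      apply hDinj v hv.1 w hw.1
      rcases lt_trichotomy (v.1 - v.2) (w.1 - w.2) with h | h | h
      · exact (hS v hv.1 w hw.1 hvw hv.2 h).elim
      · exact h
      · exact (hS w hw.1 v hv.1 hvw.symm hw.2 h).elim
    · intro v hv w hw
      simp only [s1, Finset.mem_filter] at hv hw
      exact hcast _ 5 (hP' v hv.1 w hw.1)
  have c2 : (s2.card : ℝ) ≤ 5 * (M / K) + 1 := by
    refine card_le_of_injOn_of_diam s2 (fun v => v.1 + v.2) ?_ _ (by positivity) ?_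
    · intro v hv w hw hvw
      simp only [s2, Finset.coe_filter, Set.mem_ofPred_eq] at hv hw
      apply hDinj v hv.1 w hw.1
      rcases lt_trichotomy (v.1 - v.2) (w.1 - w.2) with h | h | h
      · exact (hS' w hw.1 v hv.1 hvw.symm hw.2 h).elim
      · exact h
      · exact (hS' v hv.1 w hw.1 hvw hv.2 h).elim
    · intro v hv w hw
      simp only [s2, Finset.mem_filter] at hv hw
      exact hcast _ 5 (hP' v hv.1 w hw.1)
  have c3 : (s3.card : ℝ) ≤ 2 * (M / K) + 1 := by
    refine card_le_of_injOn_of_diam s3 (fun v => v.1 - v.2) ?_ _ (by positivity) ?_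
    · intro v hv w hw hvw
      simp only [s3, Finset.coe_filter, Set.mem_ofPred_eq] at hv hw
      exact hDinj v hv.1 w hw.1 hvw
    · intro v hv w hw
      simp only [s3, Finset.mem_filter, abs_le] at hv hw
      apply hcast _ 2
      linarith [hv.2.1, hw.2.2, mul_comm K (v.1 - v.2), mul_comm K (w.1 - w.2),
        sub_mul (w.1 - w.2) (v.1 - v.2) K]
  have h7 : (s.card : ℝ) ≤ s1.card + s2.card + s3.card := by
    have := (Finset.card_le_card hcov).trans (Finset.card_union_le _ _)
    have h8 := Finset.card_union_le s1 s2
    exact_mod_cast (by omega : s.card ≤ s1.card + s2.card + s3.card)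
  linarith

lemma cubic_value_neg (K M s b c u w g : ℤ) (hM : 1 ≤ M) (hMK : 100 * M ≤ K)
    (hb : K ≤ b ∧ b < 2 * K) (hc : K ≤ c ∧ c < 2 * K) (hs : 1 ≤ s) (hsM : s ≤ M)
    (hu : u ≤ M) (hw : -M ≤ w)
    (key : 6 * g = - s * (6 * (b * c) + 3 * s * (b + c) + s ^ 2) + 3 * (u * (b + c + s)) - 2 * w) :
    2 * g ≤ - (K ^ 2 * s) := by
  have hbc : K * K ≤ b * c := mul_le_mul hb.1 hc.1 (by omega) (by omega)
  have t1 : s * (6 * K ^ 2) ≤ s * (6 * (b * c) + 3 * s * (b + c) + s ^ 2) := by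
    apply mul_le_mul_of_nonneg_left _ (by omega)
    have : 0 ≤ s * (b + c) := mul_nonneg (by omega) (by omega)
    linarith [sq_nonneg s, sq K]
  have t2 : u * (b + c + s) ≤ M * (5 * K) :=
    calc _ ≤ M * (b + c + s) := mul_le_mul_of_nonneg_right hu (by omega)
      _ ≤ _ := mul_le_mul_of_nonneg_left (by omega) (by omega)
  have t3 : 100 * M * K ≤ K ^ 2 * s := by
    have h1 : 100 * M * K ≤ K * K := mul_le_mul_of_nonneg_right hMK (by omega)
    have h0 : K ^ 2 * 1 ≤ K ^ 2 * s := mul_le_mul_of_nonneg_left hs (by positivity)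
    linarith [sq K]
  have t4 : M * 1 ≤ M * K := mul_le_mul_of_nonneg_left (by omega) (by omega)
  linarith

lemma cubic_value_pos (K M s b c u w g : ℤ) (hM : 1 ≤ M) (hMK : 100 * M ≤ K)
    (hb : K ≤ b ∧ b < 2 * K) (hc : K ≤ c ∧ c < 2 * K) (hs : 1 ≤ s) (hsM : s ≤ M)
    (hu : -M ≤ u) (hw : w ≤ M)
    (key : 6 * g = s * (6 * (b * c) - 3 * s * (b + c) + s ^ 2) + 3 * (u * (b + c - s)) - 2 * w) :
    K ^ 2 * s ≤ 2 * g := by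
  have hbc : K * K ≤ b * c := mul_le_mul hb.1 hc.1 (by omega) (by omega)
  have h1 : 100 * M * K ≤ K * K := mul_le_mul_of_nonneg_right hMK (by omega)
  have t1 : s * (5 * K ^ 2) ≤ s * (6 * (b * c) - 3 * s * (b + c) + s ^ 2) := by
    apply mul_le_mul_of_nonneg_left _ (by omega)
    have : s * (b + c) ≤ M * (4 * K) := mul_le_mul hsM (by omega) (by omega) (by omega)
    linarith [sq_nonneg s, sq K, sq_nonneg K]
  have t2 : (-M) * (5 * K) ≤ u * (b + c - s) :=
    calc (-M) * (5 * K) ≤ (-M) * (b + c - s) :=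
          mul_le_mul_of_nonpos_left (by omega) (by omega)
      _ ≤ _ := mul_le_mul_of_nonneg_right hu (by omega)
  have t3 : 100 * M * K ≤ K ^ 2 * s := by
    have h0 : K ^ 2 * 1 ≤ K ^ 2 * s := mul_le_mul_of_nonneg_left hs (by positivity)
    linarith [sq K]
  have t4 : M * 1 ≤ M * K := mul_le_mul_of_nonneg_left (by omega) (by omega)
  linarith

lemma mul_two_mul_le_sq_sub_sq (K a x : ℤ) (hKa : K ≤ a) (h : a ≤ x) :
    (x - a) * (2 * K) ≤ x ^ 2 - a ^ 2 := by
  have : 0 ≤ (x - a) * (x + a - 2 * K) := mul_nonneg (by omega) (by omega)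
  linarith

lemma le_cube_of_cubic_neg (a x y z p : ℤ) (hp : 0 < p) (hxy : x ≤ y) (hyz : y ≤ z)
    (hax : x ≤ a) (h : 2 * ((a - x) * (a - y) * (a - z)) ≤ - p) : p ≤ 2 * (z - x) ^ 3 := by
  have haz : a ≤ z := by
    by_contra hlt
    have : 0 ≤ (a - x) * (a - y) * (a - z) :=
      mul_nonneg (mul_nonneg (by omega) (by omega)) (by omega)
    linarith
  have hay : y ≤ a := by
    by_contra hlt
    have : 0 ≤ (a - x) * (y - a) * (z - a) :=
      mul_nonneg (mul_nonneg (by omega) (by omega)) (by omega)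
    linarith
  have : (a - x) * (a - y) * (z - a) ≤ (z - x) * (z - x) * (z - x) := by
    apply mul_le_mul _ (by omega) (by omega) (mul_nonneg (by omega) (by omega))
    exact mul_le_mul (by omega) (by omega) (by omega) (by omega)
  linarith

lemma le_cube_of_cubic_pos (a x y z p : ℤ) (hp : 0 < p) (hxy : x ≤ y) (hyz : y ≤ z)
    (haz : a ≤ z) (h : p ≤ 2 * ((a - x) * (a - y) * (a - z))) : p ≤ 2 * (z - x) ^ 3 := by
  have := le_cube_of_cubic_neg (-a) (-z) (-y) (-x) p hp (by omega) (by omega) (by omega)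
    (by linarith)
  linarith

lemma spread_pos (K M a b c x y z : ℤ) (hM : 1 ≤ M) (hMK : 100 * M ≤ K)
    (ha : K ≤ a ∧ a < 2 * K) (hb : K ≤ b ∧ b < 2 * K) (hc : K ≤ c ∧ c < 2 * K)
    (hxy : x ≤ y) (hyz : y ≤ z) (h1 : 1 ≤ x + y + z - (a + b + c))
    (h1' : x + y + z - (a + b + c) ≤ M)
    (h2 : |x ^ 2 + y ^ 2 + z ^ 2 - (a ^ 2 + b ^ 2 + c ^ 2)| ≤ M)
    (h3 : |x ^ 3 + y ^ 3 + z ^ 3 - (a ^ 3 + b ^ 3 + c ^ 3)| ≤ M) :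
    K ^ 2 * (x + y + z - (a + b + c)) ≤ 2 * (z - x) ^ 3 := by
  obtain ⟨s, hs⟩ : ∃ s, s = x + y + z - (a + b + c) := ⟨_, rfl⟩
  rw [← hs] at h1 h1' ⊢
  have e2 := abs_le.1 h2
  have e3 := abs_le.1 h3
  have neg : ∀ a b c : ℤ, (K ≤ a ∧ a < 2 * K) → (K ≤ b ∧ b < 2 * K) → (K ≤ c ∧ c < 2 * K) →
      s = x + y + z - (a + b + c) →
      x ^ 2 + y ^ 2 + z ^ 2 - (a ^ 2 + b ^ 2 + c ^ 2) ≤ M →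
      -M ≤ x ^ 3 + y ^ 3 + z ^ 3 - (a ^ 3 + b ^ 3 + c ^ 3) →
      2 * ((a - x) * (a - y) * (a - z)) ≤ - (K ^ 2 * s) := by
    intro a b c ha hb hc hs hu hw
    refine cubic_value_neg K M s b c _ _ _ hM hMK hb hc h1 h1' hu hw ?_
    subst hs; ring
  have na := neg a b c ha hb hc hs e2.2 e3.1
  have nb := neg b a c hb ha hc (by omega) (by linarith [e2.2]) (by linarith [e3.1])
  have nc := neg c a b hc ha hb (by omega) (by linarith [e2.2]) (by linarith [e3.1])
  have pos : 0 < K ^ 2 * s := by have : 0 < K := by omega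
                                 have : 0 < s := by omega
                                 positivity
  have inside : ∀ a : ℤ, x ≤ a → 2 * ((a - x) * (a - y) * (a - z)) ≤ - (K ^ 2 * s) →
      K ^ 2 * s ≤ 2 * (z - x) ^ 3 :=
    fun a hax h => le_cube_of_cubic_neg a x y z _ pos hxy hyz hax h
  by_cases h : x ≤ a
  · exact inside a h na
  by_cases h' : x ≤ b
  · exact inside b h' nb
  by_cases h'' : x ≤ c
  · exact inside c h'' nc
  exfalso
  have p1 : (x - a) * (2 * K) ≤ x ^ 2 - a ^ 2 :=
    mul_two_mul_le_sq_sub_sq K a x (by omega) (by omega)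
  have p2 : (y - b) * (2 * K) ≤ y ^ 2 - b ^ 2 :=
    mul_two_mul_le_sq_sub_sq K b y (by omega) (by omega)
  have p3 : (z - c) * (2 * K) ≤ z ^ 2 - c ^ 2 :=
    mul_two_mul_le_sq_sub_sq K c z (by omega) (by omega)
  have p4 : 1 * (2 * K) ≤ s * (2 * K) := mul_le_mul_of_nonneg_right h1 (by omega)
  rw [hs] at p4
  clear na nb nc neg inside pos h2 h3 e3
  linarith [e2.2]

lemma spread_neg (K M a b c x y z : ℤ) (hM : 1 ≤ M) (hMK : 100 * M ≤ K)
    (ha : K ≤ a ∧ a < 2 * K) (hb : K ≤ b ∧ b < 2 * K) (hc : K ≤ c ∧ c < 2 * K)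
    (hx : K ≤ x) (hxy : x ≤ y) (hyz : y ≤ z)
    (h1 : 1 ≤ (a + b + c) - (x + y + z)) (h1' : (a + b + c) - (x + y + z) ≤ M)
    (h2 : |x ^ 2 + y ^ 2 + z ^ 2 - (a ^ 2 + b ^ 2 + c ^ 2)| ≤ M)
    (h3 : |x ^ 3 + y ^ 3 + z ^ 3 - (a ^ 3 + b ^ 3 + c ^ 3)| ≤ M) :
    K ^ 2 * ((a + b + c) - (x + y + z)) ≤ 2 * (z - x) ^ 3 := by
  obtain ⟨s, hs⟩ : ∃ s, s = (a + b + c) - (x + y + z) := ⟨_, rfl⟩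
  rw [← hs] at h1 h1' ⊢
  have e2 := abs_le.1 h2
  have e3 := abs_le.1 h3
  have neg : ∀ a b c : ℤ, (K ≤ a ∧ a < 2 * K) → (K ≤ b ∧ b < 2 * K) → (K ≤ c ∧ c < 2 * K) →
      s = (a + b + c) - (x + y + z) →
      -M ≤ x ^ 2 + y ^ 2 + z ^ 2 - (a ^ 2 + b ^ 2 + c ^ 2) →
      x ^ 3 + y ^ 3 + z ^ 3 - (a ^ 3 + b ^ 3 + c ^ 3) ≤ M →
      K ^ 2 * s ≤ 2 * ((a - x) * (a - y) * (a - z)) := by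
    intro a b c ha hb hc hs hu hw
    refine cubic_value_pos K M s b c _ _ _ hM hMK hb hc h1 h1' hu hw ?_
    subst hs; ring
  have na := neg a b c ha hb hc hs e2.1 e3.2
  have nb := neg b a c hb ha hc (by omega) (by linarith [e2.1]) (by linarith [e3.2])
  have nc := neg c a b hc ha hb (by omega) (by linarith [e2.1]) (by linarith [e3.2])
  have pos : 0 < K ^ 2 * s := by have : 0 < K := by omega
                                 have : 0 < s := by omega
                                 positivity
  have inside : ∀ a : ℤ, a ≤ z → K ^ 2 * s ≤ 2 * ((a - x) * (a - y) * (a - z)) →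
      K ^ 2 * s ≤ 2 * (z - x) ^ 3 :=
    fun a haz h => le_cube_of_cubic_pos a x y z _ pos hxy hyz haz h
  by_cases h : a ≤ z
  · exact inside a h na
  by_cases h' : b ≤ z
  · exact inside b h' nb
  by_cases h'' : c ≤ z
  · exact inside c h'' nc
  exfalso
  have p1 : (a - x) * (2 * K) ≤ a ^ 2 - x ^ 2 :=
    mul_two_mul_le_sq_sub_sq K x a (by omega) (by omega)
  have p2 : (b - y) * (2 * K) ≤ b ^ 2 - y ^ 2 :=
    mul_two_mul_le_sq_sub_sq K y b (by omega) (by omega)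
  have p3 : (c - z) * (2 * K) ≤ c ^ 2 - z ^ 2 :=
    mul_two_mul_le_sq_sub_sq K z c (by omega) (by omega)
  have p4 : 1 * (2 * K) ≤ s * (2 * K) := mul_le_mul_of_nonneg_right h1 (by omega)
  rw [hs] at p4
  clear na nb nc neg inside pos h2 h3 e3
  linarith [e2.1]

/-- A triple whose power sums are within `M` of those of another triple, with distinct linear
sums, is spread out. -/
lemma spread (K M a b c x y z : ℤ) (hM : 1 ≤ M) (hMK : 100 * M ≤ K)
    (ha : K ≤ a ∧ a < 2 * K) (hb : K ≤ b ∧ b < 2 * K) (hc : K ≤ c ∧ c < 2 * K)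
    (hx : K ≤ x) (hxy : x ≤ y) (hyz : y ≤ z)
    (h0 : x + y + z - (a + b + c) ≠ 0) (h1 : |x + y + z - (a + b + c)| ≤ M)
    (h2 : |x ^ 2 + y ^ 2 + z ^ 2 - (a ^ 2 + b ^ 2 + c ^ 2)| ≤ M)
    (h3 : |x ^ 3 + y ^ 3 + z ^ 3 - (a ^ 3 + b ^ 3 + c ^ 3)| ≤ M) :
    K * |x + y + z - (a + b + c)| ≤ 4 * (z - x) ^ 2 := by
  have e1 := abs_le.1 h1
  have key : K ^ 2 * |x + y + z - (a + b + c)| ≤ 2 * (z - x) ^ 3 := by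
    rcases lt_or_gt_of_ne h0 with h | h
    · rw [abs_of_neg h, neg_sub]
      exact spread_neg K M a b c x y z hM hMK ha hb hc hx hxy hyz (by omega) (by omega) h2 h3
    · rw [abs_of_pos h]
      exact spread_pos K M a b c x y z hM hMK ha hb hc hxy hyz (by omega) (by omega) h2 h3
  have hs1 : 0 < |x + y + z - (a + b + c)| := abs_pos.2 h0
  generalize |x + y + z - (a + b + c)| = s at *
  have hr0 : 0 ≤ z - x := by omega
  generalize z - x = r at *
  by_contra hlt
  push Not at hlt
  have hsK : s ≤ K := by omega
  have hrK : 2 * r < K := by nlinarith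
  have h4 : 2 * r * r ^ 2 ≤ K * r ^ 2 := mul_le_mul_of_nonneg_right hrK.le (sq_nonneg r)
  have h5 : K * (4 * r ^ 2) < K * (K * s) := mul_lt_mul_of_pos_left hlt (by omega)
  nlinarith [sq_nonneg r]

lemma prod_sub_le (K M a b c x y z : ℤ) (hM : 1 ≤ M)
    (hK : 1 ≤ K) (hb : K ≤ b ∧ b < 2 * K) (hc : K ≤ c ∧ c < 2 * K)
    (h1 : x + y + z = a + b + c)
    (h2 : |x ^ 2 + y ^ 2 + z ^ 2 - (a ^ 2 + b ^ 2 + c ^ 2)| ≤ 2 * M)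
    (h3 : |x ^ 3 + y ^ 3 + z ^ 3 - (a ^ 3 + b ^ 3 + c ^ 3)| ≤ 2 * M) :
    |a - x| * |a - y| * |a - z| ≤ 5 * (M * K) := by
  rw [← abs_mul, ← abs_mul]
  have key : 6 * ((a - x) * (a - y) * (a - z)) =
        3 * ((x ^ 2 + y ^ 2 + z ^ 2 - (a ^ 2 + b ^ 2 + c ^ 2)) * (b + c))
        - 2 * (x ^ 3 + y ^ 3 + z ^ 3 - (a ^ 3 + b ^ 3 + c ^ 3)) := by
    obtain rfl : x = a + b + c - y - z := by omega
    ring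
  have t : |(x ^ 2 + y ^ 2 + z ^ 2 - (a ^ 2 + b ^ 2 + c ^ 2)) * (b + c)| ≤ 2 * M * (4 * K) := by
    rw [abs_mul, abs_of_nonneg (by omega : 0 ≤ b + c)]
    exact mul_le_mul h2 (by omega) (by omega) (by omega)
  have e := abs_le.1 t
  have e3 := abs_le.1 h3
  have : M ≤ M * K := by nlinarith
  rw [abs_le]; constructor <;> linarith

lemma close_of_far (t x y z R B : ℝ) (hR : 0 ≤ R) (hx : R ≤ |t - x|) (hy : R ≤ |t - y|)
    (h : |t - x| * |t - y| * |t - z| ≤ B) : |t - z| * R ^ 2 ≤ B := by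
  have : R * R ≤ |t - x| * |t - y| := mul_le_mul hx hy hR (abs_nonneg _)
  nlinarith [abs_nonneg (t - z)]

lemma exists_close (a b c x y z B : ℝ) (hxy : x ≤ y) (hxz : x < z)
    (h1 : x + y + z = a + b + c)
    (ha : |a - x| * |a - y| * |a - z| ≤ B)
    (hb : |b - x| * |b - y| * |b - z| ≤ B)
    (hc : |c - x| * |c - y| * |c - z| ≤ B) :
    ∃ t ∈ ({a, b, c} : Set ℝ), ∃ r ∈ ({x, y, z} : Set ℝ), |t - r| * ((z - x) / 20) ^ 2 ≤ B := by
  set R := (z - x) / 20 with hRdef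
  have hR : 0 < R := by simp only [R]; linarith
  by_contra hcon
  push Not at hcon
  have far : ∀ t ∈ ({a, b, c} : Set ℝ), |t - x| * |t - y| * |t - z| ≤ B →
      (|t - x| < R ∧ |t - y| < R) ∨ (|t - y| < R ∧ |t - z| < R) := by
    intro t ht hB
    have kx := hcon t ht x (by simp)
    have ky := hcon t ht y (by simp)
    have kz := hcon t ht z (by simp)
    by_cases h1 : R ≤ |t - x| <;> by_cases h2 : R ≤ |t - y| <;> by_cases h3 : R ≤ |t - z|
    · exact absurd (close_of_far t x y z R B hR.le h1 h2 hB) (not_le.2 kz)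
    · exact absurd (close_of_far t x y z R B hR.le h1 h2 hB) (not_le.2 kz)
    · exact absurd (close_of_far t x z y R B hR.le h1 h3 (by linarith)) (not_le.2 ky)
    · exact Or.inr ⟨not_le.1 h2, not_le.1 h3⟩
    · exact absurd (close_of_far t y z x R B hR.le h2 h3 (by linarith)) (not_le.2 kx)
    · exfalso
      have e1 := abs_lt.1 (not_le.1 h1)
      have e3 := abs_lt.1 (not_le.1 h3)
      linarith
    · exact Or.inl ⟨not_le.1 h1, not_le.1 h2⟩
    · exact Or.inl ⟨not_le.1 h1, not_le.1 h2⟩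
  have fa := far a (by simp) ha
  have fb := far b (by simp) hb
  have fc := far c (by simp) hc
  simp only [abs_lt] at fa fb fc
  rcases fa with fa | fa <;> rcases fb with fb | fb <;> rcases fc with fc | fc <;>
    linarith [fa.1.1, fa.1.2, fa.2.1, fa.2.2, fb.1.1, fb.1.2, fb.2.1, fb.2.2, fc.1.1, fc.1.2,
      fc.2.1, fc.2.2]

/-- Two triples sharing one entry and the sum, with nearby square and cube sums. -/
lemma eq_of_entry_eq (K M a b c y z : ℤ) (hM : 1 ≤ M) (hMK : 100 * M ≤ K)
    (hb : K ≤ b ∧ b < 2 * K) (hc : K ≤ c ∧ c < 2 * K)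
    (h1 : a + y + z = a + b + c)
    (h2 : |a ^ 2 + y ^ 2 + z ^ 2 - (a ^ 2 + b ^ 2 + c ^ 2)| ≤ 2 * M)
    (h3 : |a ^ 3 + y ^ 3 + z ^ 3 - (a ^ 3 + b ^ 3 + c ^ 3)| ≤ 2 * M)
    (hord : y ≤ z ↔ b ≤ c) : y = b ∧ z = c := by
  obtain rfl : y = b + c - z := by omega
  have key : a ^ 3 + (b + c - z) ^ 3 + z ^ 3 - (a ^ 3 + b ^ 3 + c ^ 3) =
    3 * ((z - b) * (z - c) * (b + c)) := by ring
  have hz : (z - b) * (z - c) = 0 := by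
    by_contra hne
    have h4 : 1 ≤ |(z - b) * (z - c)| := Int.one_le_abs hne
    rw [key, abs_mul, abs_mul ((z - b) * (z - c)), abs_of_nonneg (by omega : 0 ≤ b + c),
      abs_of_nonneg (by norm_num : (0:ℤ) ≤ 3)] at h3
    have : 1 * (2 * K) ≤ |(z - b) * (z - c)| * (b + c) :=
      mul_le_mul h4 (by omega) (by omega) (by omega)
    omega
  rcases mul_eq_zero.1 hz with h | h
  · have : z = b := by omega
    subst this; omega
  · omega

/-- The sum of the `j`-th powers of the entries of a triple. -/
def pw (j : ℕ) (T : ℤ × ℤ × ℤ) : ℤ := T.1 ^ j + T.2.1 ^ j + T.2.2 ^ j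

/-- The triples with entries in `[K, 2K)`. -/
noncomputable def triples (K : ℤ) : Finset (ℤ × ℤ × ℤ) :=
  Finset.Ico K (2 * K) ×ˢ Finset.Ico K (2 * K) ×ˢ Finset.Ico K (2 * K)

/-- The triples with entries in `[K, 2K)` whose first three power sums are within `M` of those
of `T`. -/
noncomputable def nearTriples (K M : ℤ) (T : ℤ × ℤ × ℤ) : Finset (ℤ × ℤ × ℤ) :=
  (triples K).filter fun T' =>
    |pw 1 T' - pw 1 T| ≤ M ∧ |pw 2 T' - pw 2 T| ≤ M ∧ |pw 3 T' - pw 3 T| ≤ M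

lemma mem_triples {K : ℤ} {T : ℤ × ℤ × ℤ} :
    T ∈ triples K ↔ (K ≤ T.1 ∧ T.1 < 2 * K) ∧ (K ≤ T.2.1 ∧ T.2.1 < 2 * K) ∧
      (K ≤ T.2.2 ∧ T.2.2 < 2 * K) := by
  simp [triples, Finset.mem_product, Finset.mem_Ico]

lemma exists_sorted (T : ℤ × ℤ × ℤ) : ∃ x y z : ℤ, x ≤ y ∧ y ≤ z ∧
    (∀ K, T ∈ triples K → K ≤ x) ∧ ∀ j, x ^ j + y ^ j + z ^ j = pw j T := by
  obtain ⟨a, b, c⟩ := T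
  simp only [pw, mem_triples]
  rcases le_total a b with h1 | h1 <;> rcases le_total b c with h2 | h2 <;>
    rcases le_total a c with h3 | h3
  · exact ⟨a, b, c, h1, h2, fun K h => by omega, fun j => by ring⟩
  · exact ⟨a, b, c, h1, h2, fun K h => by omega, fun j => by ring⟩
  · exact ⟨a, c, b, h3, h2, fun K h => by omega, fun j => by ring⟩
  · exact ⟨c, a, b, h3, h1, fun K h => by omega, fun j => by ring⟩
  · exact ⟨b, a, c, h1, h3, fun K h => by omega, fun j => by ring⟩
  · exact ⟨b, c, a, h2, h3, fun K h => by omega, fun j => by ring⟩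
  · exact ⟨c, b, a, h2, h1, fun K h => by omega, fun j => by ring⟩
  · exact ⟨c, b, a, h2, h1, fun K h => by omega, fun j => by ring⟩

/-- The entries of a triple, as a function. -/
def entry (T : ℤ × ℤ × ℤ) : Fin 3 → ℤ := ![T.1, T.2.1, T.2.2]

/-- Whether the entries of a triple other than the given one are in increasing order. -/
def othersLe (T : ℤ × ℤ × ℤ) : Fin 3 → Bool :=
  ![decide (T.2.1 ≤ T.2.2), decide (T.1 ≤ T.2.2), decide (T.1 ≤ T.2.1)]

lemma eq_of_entry_of_othersLe (K M : ℤ) (T T' : ℤ × ℤ × ℤ) (hM : 1 ≤ M) (hMK : 100 * M ≤ K)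
    (hT : T ∈ triples K) (h1 : pw 1 T' = pw 1 T) (h2 : |pw 2 T' - pw 2 T| ≤ 2 * M)
    (h3 : |pw 3 T' - pw 3 T| ≤ 2 * M) (i : Fin 3) (hi : entry T' i = entry T i)
    (ho : othersLe T' i = othersLe T i) : T' = T := by
  obtain ⟨a, b, c⟩ := T
  obtain ⟨x, y, z⟩ := T'
  simp only [pw, mem_triples, pow_one] at hT h1 h2 h3
  fin_cases i <;>
    simp only [entry, othersLe, Fin.zero_eta, Fin.mk_one, Fin.reduceFinMk, Matrix.cons_val_zero,
      Matrix.cons_val_one, Matrix.cons_val, decide_eq_decide] at hi ho <;> subst hi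
  · obtain ⟨rfl, rfl⟩ := eq_of_entry_eq K M x b c y z hM hMK hT.2.1 hT.2.2 h1 h2 h3 ho
    rfl
  · obtain ⟨rfl, rfl⟩ := eq_of_entry_eq K M y a c x z hM hMK hT.1 hT.2.2 (by omega)
      (by convert h2 using 2; ring) (by convert h3 using 2; ring) ho
    rfl
  · obtain ⟨rfl, rfl⟩ := eq_of_entry_eq K M z a b x y hM hMK hT.1 hT.2.1 (by omega)
      (by convert h2 using 2; ring) (by convert h3 using 2; ring) ho
    rfl

lemma abs_sub_le_two_mul {a b c M : ℤ} (h : |a - c| ≤ M) (h' : |b - c| ≤ M) :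
    |a - b| ≤ 2 * M := by
  rw [abs_le] at *; constructor <;> omega

lemma exists_entry_close (K M s x y z : ℤ) (T : ℤ × ℤ × ℤ) (hM : 1 ≤ M)
    (hMK : 100 * M ≤ K) (hT : T ∈ triples K) (hs : s ≠ 0) (hxy : x ≤ y) (hyz : y ≤ z)
    (hsp : K * |s| ≤ 4 * (z - x) ^ 2) (h1 : x + y + z = pw 1 T)
    (h2 : |x ^ 2 + y ^ 2 + z ^ 2 - pw 2 T| ≤ 2 * M)
    (h3 : |x ^ 3 + y ^ 3 + z ^ 3 - pw 3 T| ≤ 2 * M) :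
    ∃ i j : Fin 3, |(entry T i : ℝ) - (![x, y, z] j : ℤ)| ≤ 8000 * (M / |(s : ℝ)|) := by
  obtain ⟨a, b, c⟩ := T
  simp only [pw, mem_triples, pow_one] at hT h1 h2 h3
  have hs0 : 0 < |s| := abs_pos.2 hs
  have hxz : x < z := by
    rcases (hxy.trans hyz).lt_or_eq with h | h
    · exact h
    · have := mul_pos (by omega : 0 < K) hs0
      subst h; simp at hsp; omega
  have pa := prod_sub_le K M a b c x y z hM (by omega) hT.2.1 hT.2.2 h1 h2 h3
  have pb := prod_sub_le K M b a c x y z hM (by omega) hT.1 hT.2.2 (by omega)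
    (by convert h2 using 2; ring) (by convert h3 using 2; ring)
  have pc := prod_sub_le K M c a b x y z hM (by omega) hT.1 hT.2.1 (by omega)
    (by convert h2 using 2; ring) (by convert h3 using 2; ring)
  obtain ⟨t, ht, r, hr, htr⟩ := exists_close (a : ℝ) b c x y z (5 * (M * K))
    (by exact_mod_cast hxy) (by exact_mod_cast hxz)
    (by exact_mod_cast h1) (by exact_mod_cast pa) (by exact_mod_cast pb) (by exact_mod_cast pc)
  have hsp' : (K : ℝ) * |(s : ℝ)| ≤ 4 * ((z : ℝ) - x) ^ 2 := by exact_mod_cast hsp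
  have hK0 : (0 : ℝ) < K := by exact_mod_cast (by omega : 0 < K)
  have hs0' : (0 : ℝ) < |(s : ℝ)| := by exact_mod_cast hs0
  have main : |t - r| ≤ 8000 * (M / |(s : ℝ)|) := by
    rw [← mul_div_assoc, le_div_iff₀ hs0']
    have : |t - r| * (K * |(s : ℝ)|) ≤ |t - r| * (4 * ((z : ℝ) - x) ^ 2) :=
      mul_le_mul_of_nonneg_left hsp' (abs_nonneg _)
    have : (|t - r| * |(s : ℝ)|) * K ≤ 8000 * M * K := by linarith
    exact le_of_mul_le_mul_right this hK0
  have hi : ∃ i : Fin 3, t = (entry (a, b, c) i : ℤ) := by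
    rcases ht with h | h | h
    · exact ⟨0, h⟩
    · exact ⟨1, h⟩
    · exact ⟨2, h⟩
  have hj : ∃ j : Fin 3, r = (![x, y, z] j : ℤ) := by
    rcases hr with h | h | h
    · exact ⟨0, h⟩
    · exact ⟨1, h⟩
    · exact ⟨2, h⟩
  obtain ⟨i, rfl⟩ := hi
  obtain ⟨j, rfl⟩ := hj
  exact ⟨i, j, main⟩

lemma card_nearTriples_fiber_le (K M s : ℤ) (T : ℤ × ℤ × ℤ) (hM : 1 ≤ M)
    (hMK : 100 * M ≤ K) (hT : T ∈ triples K) (hs : s ≠ 0) (hsM : |s| ≤ M) :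
    (((nearTriples K M T).filter fun T' => pw 1 T' - pw 1 T = s).card : ℝ) ≤
      288018 * (M / |(s : ℝ)|) := by
  set A := (nearTriples K M T).filter fun T' => pw 1 T' - pw 1 T = s with hA
  have hs0 : (0 : ℝ) < |(s : ℝ)| := abs_pos.2 (by exact_mod_cast hs)
  have hM1 : 1 ≤ (M / |(s : ℝ)|) := by
    rw [le_div_iff₀ hs0, one_mul]; exact_mod_cast hsM
  rcases A.eq_empty_or_nonempty with h | ⟨T₀, h₀⟩
  · rw [h]; simp only [Finset.card_empty, Nat.cast_zero]; linarith
  obtain ⟨x, y, z, hxy, hyz, hKx, hp⟩ := exists_sorted T₀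
  have mem : ∀ T' ∈ A, T' ∈ triples K ∧ pw 1 T' - pw 1 T = s ∧ |pw 2 T' - pw 2 T| ≤ M ∧
      |pw 3 T' - pw 3 T| ≤ M := by
    intro T' h
    simp only [hA, nearTriples, Finset.mem_filter] at h
    tauto
  have m₀ := mem T₀ h₀
  have hsp : K * |s| ≤ 4 * (z - x) ^ 2 := by
    have hT' := mem_triples.1 hT
    have e1 : x + y + z - (T.1 + T.2.1 + T.2.2) = s := by
      have := hp 1
      rw [← m₀.2.1, ← this]; simp [pw]
    have := spread K M T.1 T.2.1 T.2.2 x y z hM hMK hT'.1 hT'.2.1 hT'.2.2 (hKx K m₀.1) hxy hyz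
      (by omega) (by rw [e1]; exact hsM) (by rw [hp]; exact m₀.2.2.1)
      (by rw [hp]; exact m₀.2.2.2)
    rwa [e1] at this
  have close : ∀ T' ∈ A, ∃ q : Fin 3 × Fin 3 × Bool, othersLe T' q.1 = q.2.2 ∧
      |(entry T' q.1 : ℝ) - (![x, y, z] q.2.1 : ℤ)| ≤ 8000 * (M / |(s : ℝ)|) := by
    intro T' h'
    have m := mem T' h'
    obtain ⟨i, j, hij⟩ := exists_entry_close K M s x y z T' hM hMK m.1 hs hxy hyz hsp
      (by have := hp 1; simp only [pow_one] at this; omega)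
      (by rw [hp]; exact abs_sub_le_two_mul m₀.2.2.1 m.2.2.1)
      (by rw [hp]; exact abs_sub_le_two_mul m₀.2.2.2 m.2.2.2)
    exact ⟨(i, j, othersLe T' i), rfl, hij⟩
  choose! f hf using close
  have := card_le_card_mul_of_fiber A (Finset.univ : Finset (Fin 3 × Fin 3 × Bool)) f
    (fun _ _ => Finset.mem_univ _) (16001 * (M / |(s : ℝ)|)) (by
      rintro ⟨i, j, o⟩ -
      refine (card_le_of_injOn_of_diam _ (fun T' => entry T' i) ?_ (16000 * (M / |(s : ℝ)|))
        (by linarith) ?_).trans (by linarith)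
      · intro T₁ h₁ T₂ h₂ h
        simp only [Finset.coe_filter, Set.mem_ofPred_eq] at h₁ h₂
        have m₁ := mem T₁ h₁.1
        have m₂ := mem T₂ h₂.1
        have f₁ := (hf T₁ h₁.1).1
        have f₂ := (hf T₂ h₂.1).1
        rw [h₁.2] at f₁
        rw [h₂.2] at f₂
        exact eq_of_entry_of_othersLe K M T₂ T₁ hM hMK m₂.1 (by omega)
          (abs_sub_le_two_mul m₁.2.2.1 m₂.2.2.1) (abs_sub_le_two_mul m₁.2.2.2 m₂.2.2.2) i h
          (f₁.trans f₂.symm)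
      · intro T₁ h₁ T₂ h₂
        simp only [Finset.mem_filter] at h₁ h₂
        have f₁ := (hf T₁ h₁.1).2
        have f₂ := (hf T₂ h₂.1).2
        rw [h₁.2] at f₁
        rw [h₂.2] at f₂
        dsimp only at f₁ f₂
        have := (abs_le.1 f₁).1
        have := (abs_le.1 f₂).2
        push_cast
        linarith)
  refine this.trans (le_of_eq ?_)
  simp
  ring

lemma exists_card_divisors_le (ε : ℝ) (hε : 0 < ε) :
    ∃ C : ℝ, 1 ≤ C ∧ ∀ m : ℕ, m ≠ 0 → (m.divisors.card : ℝ) ≤ C * (m : ℝ) ^ ε := by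
  set P : ℕ := ⌈(2 : ℝ) ^ (1 / ε)⌉₊ with hP
  have hlog : 0 < Real.log 2 := Real.log_pos (by norm_num)
  set C₀ : ℝ := 1 + 1 / (ε * Real.log 2) with hC₀
  have hC₀1 : 1 ≤ C₀ := by rw [hC₀]; have : 0 ≤ 1 / (ε * Real.log 2) := by positivity
                           linarith
  have factor : ∀ p a : ℕ, 2 ≤ p →
      ((a + 1 : ℕ) : ℝ) ≤ (if p < P then C₀ else 1) * ((p : ℝ) ^ a) ^ ε := by
    intro p a hp
    have hp0 : (2 : ℝ) ≤ p := by exact_mod_cast hp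
    have hcomm : ((p : ℝ) ^ a) ^ ε = ((p : ℝ) ^ ε) ^ a := by
      rw [← Real.rpow_natCast, ← Real.rpow_natCast, ← Real.rpow_mul (by linarith),
        ← Real.rpow_mul (by linarith), mul_comm]
    rw [hcomm]
    split_ifs with h
    · have h1 : 1 + ε * Real.log 2 ≤ (p : ℝ) ^ ε := by
        calc 1 + ε * Real.log 2 ≤ Real.exp (ε * Real.log 2) := by
              linarith [Real.add_one_le_exp (ε * Real.log 2)]
          _ = (2 : ℝ) ^ ε := by rw [Real.rpow_def_of_pos (by norm_num), mul_comm]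
          _ ≤ _ := Real.rpow_le_rpow (by norm_num) hp0 hε.le
      have h2 : 1 + a * (ε * Real.log 2) ≤ ((p : ℝ) ^ ε) ^ a :=
        (one_add_mul_le_pow (by nlinarith [mul_pos hε hlog]) a).trans
          (pow_le_pow_left₀ (by positivity) h1 a)
      calc ((a + 1 : ℕ) : ℝ) ≤ C₀ * (1 + a * (ε * Real.log 2)) := by
            rw [hC₀]
            push_cast
            have h0 : 0 < ε * Real.log 2 := by positivity
            have e : (1 + 1 / (ε * Real.log 2)) * (1 + a * (ε * Real.log 2)) =
              1 + a + (1 / (ε * Real.log 2) + a * (ε * Real.log 2)) := by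
              field_simp; ring
            rw [e]
            have : 0 ≤ 1 / (ε * Real.log 2) + a * (ε * Real.log 2) := by positivity
            linarith
        _ ≤ _ := mul_le_mul_of_nonneg_left h2 (by linarith)
    · have h1 : (2 : ℝ) ≤ (p : ℝ) ^ ε := by
        have : (2 : ℝ) ^ (1 / ε) ≤ p := (Nat.le_ceil _).trans (by exact_mod_cast not_lt.1 h)
        calc (2 : ℝ) = ((2 : ℝ) ^ (1 / ε)) ^ ε := by
              rw [← Real.rpow_mul (by norm_num), one_div_mul_cancel hε.ne', Real.rpow_one]
          _ ≤ _ := Real.rpow_le_rpow (by positivity) this hε.le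
      rw [one_mul]
      calc ((a + 1 : ℕ) : ℝ) ≤ (2 : ℝ) ^ a := by exact_mod_cast Nat.lt_two_pow_self
        _ ≤ _ := pow_le_pow_left₀ (by norm_num) h1 a
  refine ⟨C₀ ^ P, one_le_pow₀ hC₀1, fun m hm => ?_⟩
  rw [Nat.card_divisors hm]
  have hprod : (m : ℝ) ^ ε = ∏ p ∈ m.primeFactors, ((p : ℝ) ^ m.factorization p) ^ ε := by
    rw [Real.finsetProd_rpow _ _ (fun _ _ => by positivity)]
    congr 1
    exact_mod_cast (Nat.prod_factorization_pow_eq_self hm).symm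
  rw [hprod]
  push_cast
  calc ∏ p ∈ m.primeFactors, ((m.factorization p : ℝ) + 1)
      ≤ ∏ p ∈ m.primeFactors,
          (if p < P then C₀ else 1) * ((p : ℝ) ^ m.factorization p) ^ ε := by
        refine Finset.prod_le_prod (fun _ _ => by positivity) fun p hp => ?_
        exact_mod_cast factor p (m.factorization p) (Nat.prime_of_mem_primeFactors hp).two_le
    _ = (∏ p ∈ m.primeFactors, if p < P then C₀ else 1) *
          ∏ p ∈ m.primeFactors, ((p : ℝ) ^ m.factorization p) ^ ε := Finset.prod_mul_distrib
    _ ≤ _ := by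
        refine mul_le_mul_of_nonneg_right ?_ (Finset.prod_nonneg fun _ _ => by positivity)
        rw [Finset.prod_ite]
        simp only [Finset.prod_const, one_pow, mul_one]
        refine pow_le_pow_right₀ hC₀1 ?_
        calc _ ≤ (Finset.range P).card := Finset.card_le_card fun p hp => by
              simpa using (Finset.mem_filter.1 hp).2
          _ = P := Finset.card_range P

lemma card_triples_fiber_le (K P Q : ℤ) (s : Finset (ℤ × ℤ × ℤ)) (hK : 1 ≤ K)
    (hs : ∀ T ∈ s, T ∈ triples K ∧ pw 1 T = P ∧ pw 3 T = Q) (B : ℝ)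
    (hdiv : ∀ m : ℕ, m ≠ 0 → (m : ℝ) ≤ (4 * K : ℝ) ^ 3 → (m.divisors.card : ℝ) ≤ B) :
    (s.card : ℝ) ≤ B ^ 2 := by
  rcases s.eq_empty_or_nonempty with h | ⟨T₀, h₀⟩
  · rw [h]; simpa using sq_nonneg B
  set m : ℕ := ((T₀.1 + T₀.2.1) * (T₀.2.1 + T₀.2.2) * (T₀.2.2 + T₀.1)).natAbs with hm
  have fac : ∀ T ∈ s, m = (T.1 + T.2.1).natAbs * (T.2.1 + T.2.2).natAbs * (T.2.2 + T.1).natAbs := by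
    intro T h
    have e := hs T h
    have e₀ := hs T₀ h₀
    rw [hm, ← Int.natAbs_mul, ← Int.natAbs_mul]
    congr 1
    have key : ∀ T : ℤ × ℤ × ℤ, 3 * ((T.1 + T.2.1) * (T.2.1 + T.2.2) * (T.2.2 + T.1)) =
        pw 1 T ^ 3 - pw 3 T := by intro T; simp only [pw]; ring
    have k1 := key T
    have k2 := key T₀
    rw [e.2.1, e.2.2] at k1
    rw [e₀.2.1, e₀.2.2] at k2
    omega
  have t₀ := mem_triples.1 (hs T₀ h₀).1
  have hm0 : m ≠ 0 := by
    rw [fac T₀ h₀]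
    refine mul_ne_zero (mul_ne_zero ?_ ?_) ?_ <;> omega
  have hmK : (m : ℝ) ≤ (4 * K : ℝ) ^ 3 := by
    have : (m : ℤ) ≤ (4 * K) ^ 3 := by
      rw [fac T₀ h₀]
      push_cast
      rw [abs_of_nonneg (by omega : 0 ≤ T₀.1 + T₀.2.1),
        abs_of_nonneg (by omega : 0 ≤ T₀.2.1 + T₀.2.2),
        abs_of_nonneg (by omega : 0 ≤ T₀.2.2 + T₀.1), pow_succ, pow_two]
      exact mul_le_mul (mul_le_mul (by omega) (by omega) (by omega) (by omega)) (by omega)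
        (by omega) (mul_nonneg (by omega) (by omega))
    exact_mod_cast this
  have hd := hdiv m hm0 hmK
  have : s.card ≤ (m.divisors ×ˢ m.divisors).card := by
    refine Finset.card_le_card_of_injOn
      (fun T => ((T.1 + T.2.1).natAbs, (T.2.1 + T.2.2).natAbs)) ?_ ?_
    · intro T h
      have f := fac T h
      simp only [Finset.coe_product, Set.mem_prod, Finset.mem_coe, Nat.mem_divisors]
      exact ⟨⟨⟨_, by rw [f, mul_assoc]⟩, hm0⟩,
        ⟨⟨(T.1 + T.2.1).natAbs * (T.2.2 + T.1).natAbs, by rw [f]; ring⟩, hm0⟩⟩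
    · intro T h T' h' heq
      have t := hs T h
      have t' := hs T' h'
      have a := mem_triples.1 t.1
      have a' := mem_triples.1 t'.1
      have p := t.2.1.trans t'.2.1.symm
      simp only [Prod.mk.injEq] at heq
      simp only [pw, pow_one] at p
      obtain ⟨x, y, z⟩ := T
      obtain ⟨x', y', z'⟩ := T'
      simp only [Prod.mk.injEq]
      dsimp only at *
      omega
  calc (s.card : ℝ) ≤ (m.divisors ×ˢ m.divisors).card := by exact_mod_cast this
    _ = (m.divisors.card : ℝ) ^ 2 := by rw [Finset.card_product]; push_cast; ring
    _ ≤ B ^ 2 := pow_le_pow_left₀ (by positivity) hd 2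

lemma sum_inv_succ_le (n : ℕ) : ∑ k ∈ Finset.range n, 1 / ((k : ℝ) + 1) ≤ 1 + Real.log n := by
  have := harmonic_le_one_add_log n
  simp only [harmonic] at this
  push_cast at this
  simpa [one_div] using this

lemma card_nearTriples_le_of_small (K M : ℤ) (T : ℤ × ℤ × ℤ) (hM : 1 ≤ M)
    (hMK : 100 * M ≤ K) (hT : T ∈ triples K) (B : ℝ)
    (hdiv : ∀ m : ℕ, m ≠ 0 → (m : ℝ) ≤ (4 * K : ℝ) ^ 3 → (m.divisors.card : ℝ) ≤ B) :
    ((nearTriples K M T).card : ℝ) ≤ M * (3 * B ^ 2 + 576036 * (1 + Real.log K)) := by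
  have hM' : (1 : ℝ) ≤ M := by exact_mod_cast hM
  have mem : ∀ T' ∈ nearTriples K M T, T' ∈ triples K ∧ |pw 1 T' - pw 1 T| ≤ M ∧
      |pw 2 T' - pw 2 T| ≤ M ∧ |pw 3 T' - pw 3 T| ≤ M := by
    intro T' h
    simpa only [nearTriples, Finset.mem_filter] using h
  have zero : (((nearTriples K M T).filter fun T' => pw 1 T' = pw 1 T).card : ℝ) ≤
      M * (3 * B ^ 2) := by
    have := card_le_card_mul_of_fiber ((nearTriples K M T).filter fun T' => pw 1 T' = pw 1 T)
      (Finset.Icc (pw 3 T - M) (pw 3 T + M)) (pw 3) (fun T' h => by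
        have := abs_le.1 (mem T' (Finset.mem_filter.1 h).1).2.2.2
        rw [Finset.mem_Icc]; omega) (B ^ 2) (fun Q _ => by
        refine card_triples_fiber_le K (pw 1 T) Q _ (by omega) (fun T' h => ?_) B hdiv
        simp only [Finset.mem_filter] at h
        exact ⟨(mem T' h.1.1).1, h.1.2, h.2⟩)
    refine this.trans ?_
    have hc : ((Finset.Icc (pw 3 T - M) (pw 3 T + M)).card : ℝ) ≤ 3 * M := by
      have : ((Finset.Icc (pw 3 T - M) (pw 3 T + M)).card : ℤ) ≤ 3 * M := by
        rw [Int.card_Icc]; omega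
      exact_mod_cast this
    calc _ ≤ 3 * (M : ℝ) * B ^ 2 := mul_le_mul_of_nonneg_right hc (sq_nonneg B)
      _ = _ := by ring
  have nonzero : (((nearTriples K M T).filter fun T' => ¬ pw 1 T' = pw 1 T).card : ℝ) ≤
      M * (576036 * (1 + Real.log K)) := by
    set A := (nearTriples K M T).filter fun T' => ¬ pw 1 T' = pw 1 T with hA
    have hcard := Finset.card_eq_sum_card_fiberwise (s := A) (t := Finset.range M.toNat)
      (f := fun T' => (pw 1 T' - pw 1 T).natAbs - 1) (fun T' h => by
        have h := Finset.mem_filter.1 (Finset.mem_coe.1 h)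
        have h1 := abs_le.1 (mem T' h.1).2.1
        have h2 := h.2
        simp only [Finset.coe_range, Set.mem_Iio]
        omega)
    have each : ∀ k ∈ Finset.range M.toNat,
        ((A.filter fun T' => (pw 1 T' - pw 1 T).natAbs - 1 = k).card : ℝ) ≤
          576036 * M * (1 / ((k : ℝ) + 1)) := by
      intro k hk
      have hk := Finset.mem_range.1 hk
      have sub : (A.filter fun T' => (pw 1 T' - pw 1 T).natAbs - 1 = k) ⊆
          ((nearTriples K M T).filter fun T' => pw 1 T' - pw 1 T = ((k : ℤ) + 1)) ∪
          ((nearTriples K M T).filter fun T' => pw 1 T' - pw 1 T = -((k : ℤ) + 1)) := by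
        intro T' h
        simp only [hA, Finset.mem_filter, Finset.mem_union] at h ⊢
        have := h.1.2
        have := h.2
        rcases le_total 0 (pw 1 T' - pw 1 T) with h0 | h0
        · exact Or.inl ⟨h.1.1, by omega⟩
        · exact Or.inr ⟨h.1.1, by omega⟩
      have c1 := card_nearTriples_fiber_le K M ((k : ℤ) + 1) T hM hMK hT (by omega)
        (by rw [abs_of_nonneg (by omega)]; omega)
      have c2 := card_nearTriples_fiber_le K M (-((k : ℤ) + 1)) T hM hMK hT (by omega)
        (by rw [abs_neg, abs_of_nonneg (by omega)]; omega)
      push_cast at c1 c2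
      rw [abs_neg] at c2
      rw [abs_of_nonneg (by positivity : (0 : ℝ) ≤ (k : ℝ) + 1)] at c1 c2
      have : ((A.filter fun T' => (pw 1 T' - pw 1 T).natAbs - 1 = k).card : ℝ) ≤
          ((nearTriples K M T).filter fun T' => pw 1 T' - pw 1 T = ((k : ℤ) + 1)).card +
          ((nearTriples K M T).filter fun T' => pw 1 T' - pw 1 T = -((k : ℤ) + 1)).card := by
        exact_mod_cast (Finset.card_le_card sub).trans (Finset.card_union_le _ _)
      have e : 576036 * (M : ℝ) * (1 / ((k : ℝ) + 1)) =
        288018 * (M / ((k : ℝ) + 1)) + 288018 * (M / ((k : ℝ) + 1)) := by ring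
      rw [e]
      linarith
    rw [hcard]
    push_cast
    refine (Finset.sum_le_sum each).trans ?_
    rw [← Finset.mul_sum]
    have h1 := sum_inv_succ_le M.toNat
    have h2 : Real.log (M.toNat : ℝ) ≤ Real.log K := by
      apply Real.log_le_log
      · exact_mod_cast (by omega : 0 < M.toNat)
      · exact_mod_cast (by omega : (M.toNat : ℤ) ≤ K)
    calc _ ≤ 576036 * (M : ℝ) * (1 + Real.log K) :=
          mul_le_mul_of_nonneg_left (by linarith) (by linarith)
      _ = _ := by ring
  have := Finset.card_filter_add_card_filter_not (s := nearTriples K M T)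
    (fun T' => pw 1 T' = pw 1 T)
  have h : ((nearTriples K M T).card : ℝ) =
      ((nearTriples K M T).filter fun T' => pw 1 T' = pw 1 T).card +
      ((nearTriples K M T).filter fun T' => ¬ pw 1 T' = pw 1 T).card := by exact_mod_cast this.symm
  rw [h, mul_add]
  linarith

lemma card_nearTriples_le_of_medium (K M : ℤ) (T : ℤ × ℤ × ℤ) (hK : 1 ≤ K) (hKM : K ≤ M)
    (hMK : M ≤ K ^ 2) : ((nearTriples K M T).card : ℝ) ≤ 30 * M := by
  have hK' : (0 : ℝ) < K := by exact_mod_cast (by omega : 0 < K)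
  have := card_le_card_mul_of_fiber (nearTriples K M T) (Finset.Ico K (2 * K)) (fun T' => T'.2.2)
    (fun T' h => Finset.mem_Ico.2 (mem_triples.1 (Finset.mem_filter.1 h).1).2.2)
    (30 * (M / K : ℝ)) (fun w _ => by
      classical
      set S := (nearTriples K M T).filter fun T' => T'.2.2 = w with hS
      have mem : ∀ T' ∈ S, T' ∈ triples K ∧
          |pw 2 T' - pw 2 T| ≤ M ∧ |pw 3 T' - pw 3 T| ≤ M ∧ T'.2.2 = w := by
        intro T' h
        simp only [hS, nearTriples, Finset.mem_filter] at h
        tauto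
      have hinj : Set.InjOn (fun T' : ℤ × ℤ × ℤ => (T'.1, T'.2.1)) (S : Set (ℤ × ℤ × ℤ)) := by
        intro T₁ h₁ T₂ h₂ h
        have e₁ := (mem T₁ h₁).2.2.2
        have e₂ := (mem T₂ h₂).2.2.2
        simp only [Prod.mk.injEq] at h
        exact Prod.ext h.1 (Prod.ext h.2 (e₁.trans e₂.symm))
      rw [← Finset.card_image_of_injOn hinj]
      have diff : ∀ j T₁ T₂, T₁ ∈ S → T₂ ∈ S → (T₁.1 ^ j + T₁.2.1 ^ j) -
          (T₂.1 ^ j + T₂.2.1 ^ j) = pw j T₁ - pw j T₂ := by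
        intro j T₁ T₂ h₁ h₂
        simp only [pw, (mem T₁ h₁).2.2.2, (mem T₂ h₂).2.2.2]; ring
      refine card_pairs_le K M hK hKM hMK _ ?_ ?_ ?_
      · simp only [Finset.forall_mem_image]
        intro T' h
        have := mem_triples.1 (mem T' h).1
        tauto
      · simp only [Finset.forall_mem_image]
        intro T₁ h₁ T₂ h₂
        rw [diff 2 _ _ (by assumption) (by assumption)]
        exact abs_sub_le_two_mul (mem _ (by assumption)).2.1 (mem _ (by assumption)).2.1
      · simp only [Finset.forall_mem_image]
        intro T₁ h₁ T₂ h₂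
        rw [diff 3 _ _ (by assumption) (by assumption)]
        exact abs_sub_le_two_mul (mem _ (by assumption)).2.2.1 (mem _ (by assumption)).2.2.1)
  refine this.trans (le_of_eq ?_)
  have hc : ((Finset.Ico K (2 * K)).card : ℝ) = K := by
    have : ((Finset.Ico K (2 * K)).card : ℤ) = K := by rw [Int.card_Ico]; omega
    exact_mod_cast this
  rw [hc]
  field_simp

lemma card_nearTriples_le_of_large (K M : ℤ) (T : ℤ × ℤ × ℤ) (hK : 1 ≤ K)
    (hMK : K ^ 2 ≤ M) : ((nearTriples K M T).card : ℝ) ≤ 2 * M := by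
  have hK' : (0 : ℝ) < K := by exact_mod_cast (by omega : 0 < K)
  have hMK' : (K : ℝ) ^ 2 ≤ M := by exact_mod_cast hMK
  have hone : 1 ≤ (M / (K : ℝ) ^ 2) := by rwa [le_div_iff₀ (by positivity), one_mul]
  have := card_le_card_mul_of_fiber (nearTriples K M T)
    (Finset.Ico K (2 * K) ×ˢ Finset.Ico K (2 * K)) (fun T' => (T'.1, T'.2.1))
    (fun T' h => by
      have := mem_triples.1 (Finset.mem_filter.1 h).1
      simp only [Finset.mem_product, Finset.mem_Ico]
      tauto)
    (2 * (M / (K : ℝ) ^ 2)) (fun w _ => by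
      refine (card_le_of_injOn_of_diam _ (fun T' => T'.2.2) ?_ (M / (K : ℝ) ^ 2)
        (by linarith) ?_).trans (by linarith)
      · intro T₁ h₁ T₂ h₂ h
        simp only [Finset.coe_filter, Set.mem_ofPred_eq] at h₁ h₂
        have e := h₁.2.trans h₂.2.symm
        simp only [Prod.mk.injEq] at e
        exact Prod.ext e.1 (Prod.ext e.2 h)
      · intro T₁ h₁ T₂ h₂
        simp only [nearTriples, Finset.mem_filter] at h₁ h₂
        have e := h₁.2.trans h₂.2.symm
        simp only [Prod.mk.injEq] at e
        have t₁ := (mem_triples.1 h₁.1.1).2.2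
        have t₂ := (mem_triples.1 h₂.1.1).2.2
        have h3 := abs_sub_le_two_mul h₁.1.2.2.2 h₂.1.2.2.2
        obtain ⟨x, y, z⟩ := T₁
        obtain ⟨x', y', z'⟩ := T₂
        dsimp only at *
        obtain ⟨rfl, rfl⟩ := e
        simp only [pw] at h3
        rw [le_div_iff₀ (by positivity)]
        have hM0 : 0 ≤ M := (sq_nonneg K).trans hMK
        have main : (z' - z) * K ^ 2 ≤ M := by
          rcases le_total z' z with hz | hz
          · exact (mul_nonpos_of_nonpos_of_nonneg (by omega) (sq_nonneg K)).trans hM0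
          · have h4 : z' ^ 3 - z ^ 3 ≤ 2 * M := by have := (abs_le.1 h3).1; linarith
            have q : 3 * K ^ 2 ≤ z' ^ 2 + z' * z + z ^ 2 := by
              have a1 := mul_le_mul t₂.1 t₁.1 (by omega) (by omega)
              have a2 := mul_le_mul t₂.1 t₂.1 (by omega) (by omega)
              have a3 := mul_le_mul t₁.1 t₁.1 (by omega) (by omega)
              linarith
            have := mul_le_mul_of_nonneg_left q (by omega : 0 ≤ z' - z)
            linarith
        exact_mod_cast main)
  refine this.trans (le_of_eq ?_)
  have hc : ((Finset.Ico K (2 * K)).card : ℝ) = K := by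
    have : ((Finset.Ico K (2 * K)).card : ℤ) = K := by rw [Int.card_Ico]; omega
    exact_mod_cast this
  rw [Finset.card_product, Nat.cast_mul, hc]
  field_simp

lemma card_nearTriples_le (K M : ℤ) (T : ℤ × ℤ × ℤ) (hK : 1 ≤ K) (hM : 1 ≤ M)
    (hT : T ∈ triples K) (B : ℝ)
    (hdiv : ∀ m : ℕ, m ≠ 0 → (m : ℝ) ≤ (4 * K : ℝ) ^ 3 → (m.divisors.card : ℝ) ≤ B) :
    ((nearTriples K M T).card : ℝ) ≤ M * (3 * B ^ 2 + 576036 * (1 + Real.log K) + 3000) := by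
  have hM' : (1 : ℝ) ≤ M := by exact_mod_cast hM
  have hlog : 0 ≤ Real.log K := Real.log_nonneg (by exact_mod_cast hK)
  have hle : (3000 : ℝ) * M ≤ M * (3 * B ^ 2 + 576036 * (1 + Real.log K) + 3000) := by
    have : 0 ≤ M * (3 * B ^ 2 + 576036 * (1 + Real.log K)) := by positivity
    linarith
  by_cases h1 : 100 * M ≤ K
  · refine (card_nearTriples_le_of_small K M T hM h1 hT B hdiv).trans ?_
    exact mul_le_mul_of_nonneg_left (by linarith) (by linarith)
  by_cases h2 : M ≤ K
  · have hsub : nearTriples K M T ⊆ nearTriples K K T := fun T' h => by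
      simp only [nearTriples, Finset.mem_filter] at h ⊢
      exact ⟨h.1, h.2.1.trans h2, h.2.2.1.trans h2, h.2.2.2.trans h2⟩
    have h3 := card_nearTriples_le_of_medium K K T hK le_rfl (by nlinarith)
    have h4 : ((nearTriples K M T).card : ℝ) ≤ (nearTriples K K T).card := by
      exact_mod_cast Finset.card_le_card hsub
    have h5 : (K : ℝ) ≤ 100 * M := by exact_mod_cast (by omega : K ≤ 100 * M)
    linarith
  by_cases h3 : M ≤ K ^ 2
  · have := card_nearTriples_le_of_medium K M T hK (by omega) h3
    linarith
  · have := card_nearTriples_le_of_large K M T hK (by omega)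
    linarith

lemma exists_card_nearTriples_le (ε : ℝ) (hε : 0 < ε) : ∃ C : ℝ, 0 < C ∧ ∀ (K M : ℤ)
    (T : ℤ × ℤ × ℤ), 1 ≤ K → 1 ≤ M → T ∈ triples K →
    ((nearTriples K M T).card : ℝ) ≤ C * (K : ℝ) ^ ε * M := by
  obtain ⟨C, hC, hdiv⟩ := exists_card_divisors_le (ε / 6) (by positivity)
  refine ⟨3 * (C * (4 : ℝ) ^ (ε / 2)) ^ 2 + 576036 * (1 + 1 / ε) + 3000, by positivity,
    fun K M T hK hM hT => ?_⟩
  have hK' : (1 : ℝ) ≤ K := by exact_mod_cast hK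
  have hM' : (1 : ℝ) ≤ M := by exact_mod_cast hM
  have h := card_nearTriples_le K M T hK hM hT (C * ((4 * K : ℝ) ^ 3) ^ (ε / 6))
    (fun m hm hle => (hdiv m hm).trans (mul_le_mul_of_nonneg_left
      (Real.rpow_le_rpow (by positivity) hle (by positivity)) (by linarith)))
  refine h.trans ?_
  rw [mul_comm]
  refine mul_le_mul_of_nonneg_right ?_ (by linarith)
  have e1 : (C * ((4 * K : ℝ) ^ 3) ^ (ε / 6)) ^ 2 = (C * (4 : ℝ) ^ (ε / 2)) ^ 2 * (K : ℝ) ^ ε := by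
    have : ((4 * K : ℝ) ^ 3) ^ (ε / 6) = (4 : ℝ) ^ (ε / 2) * (K : ℝ) ^ (ε / 2) := by
      rw [← Real.rpow_natCast, ← Real.rpow_mul (by positivity),
        Real.mul_rpow (by norm_num) (by linarith)]
      congr 2 <;> push_cast <;> ring
    rw [this]
    have : (K : ℝ) ^ ε = ((K : ℝ) ^ (ε / 2)) ^ 2 := by
      rw [← Real.rpow_natCast, ← Real.rpow_mul (by positivity)]
      congr 1; push_cast; ring
    rw [this]; ring
  have e2 : Real.log K ≤ (K : ℝ) ^ ε * (1 / ε) := by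
    have := Real.log_le_rpow_div (by linarith : (0 : ℝ) ≤ K) hε
    rwa [div_eq_mul_one_div] at this
  have e3 : 1 ≤ (K : ℝ) ^ ε := Real.one_le_rpow hK' hε.le
  rw [e1]
  linarith

/-- The largest difference of the first three power sums of two triples. -/
def gap (T T' : ℤ × ℤ × ℤ) : ℕ :=
  max (pw 1 T' - pw 1 T).natAbs (max (pw 2 T' - pw 2 T).natAbs (pw 3 T' - pw 3 T).natAbs)

lemma one_div_succ_eq_sum (m R : ℕ) (h : m ≤ R) : 1 / ((m : ℝ) + 1) =
    1 / ((R : ℝ) + 1) +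
      ∑ i ∈ Finset.range R, if m ≤ i then 1 / (((i : ℝ) + 1) * ((i : ℝ) + 2)) else 0 := by
  induction R, h using Nat.le_induction with
  | base =>
    rw [Finset.sum_eq_zero, add_zero]
    intro i hi
    rw [if_neg (by simpa using hi)]
  | succ n hn ih =>
    rw [Finset.sum_range_succ, if_pos hn, ih]
    push_cast
    field_simp
    ring

lemma gap_le (K : ℤ) (T T' : ℤ × ℤ × ℤ) (hK : 1 ≤ K) (hT : T ∈ triples K)
    (hT' : T' ∈ triples K) : (gap T T' : ℤ) ≤ 24 * K ^ 3 := by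
  have b2 : ∀ x : ℤ, K ≤ x ∧ x < 2 * K → 0 ≤ x ^ 2 ∧ x ^ 2 ≤ 4 * K ^ 2 := fun x hx =>
    ⟨sq_nonneg x, by have := pow_le_pow_left₀ (by omega) hx.2.le 2; linarith⟩
  have b3 : ∀ x : ℤ, K ≤ x ∧ x < 2 * K → 0 ≤ x ^ 3 ∧ x ^ 3 ≤ 8 * K ^ 3 := fun x hx =>
    ⟨pow_nonneg (by omega) 3, by have := pow_le_pow_left₀ (by omega) hx.2.le 3; linarith⟩
  have k2 : K ^ 2 ≤ K ^ 3 := pow_le_pow_right₀ hK (by norm_num)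
  have k1 : K ≤ K ^ 3 := le_self_pow₀ hK (by norm_num)
  have t := mem_triples.1 hT
  have t' := mem_triples.1 hT'
  have := b2 _ t.1
  have := b2 _ t.2.1
  have := b2 _ t.2.2
  have := b2 _ t'.1
  have := b2 _ t'.2.1
  have := b2 _ t'.2.2
  have := b3 _ t.1
  have := b3 _ t.2.1
  have := b3 _ t.2.2
  have := b3 _ t'.1
  have := b3 _ t'.2.1
  have := b3 _ t'.2.2
  simp only [gap, pw, pow_one]
  push_cast
  refine max_le ?_ (max_le ?_ ?_) <;> rw [abs_le] <;> constructor <;> linarith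

/-- Row sums of the kernel `1 / (1 + gap)`. -/
lemma exists_sum_one_div_gap_le (ε : ℝ) (hε : 0 < ε) : ∃ C : ℝ, 0 < C ∧ ∀ (K : ℤ)
    (T : ℤ × ℤ × ℤ), 1 ≤ K → T ∈ triples K →
    ∑ T' ∈ triples K, 1 / ((gap T T' : ℝ) + 1) ≤ C * (K : ℝ) ^ ε := by
  obtain ⟨C, hC, hcount⟩ := exists_card_nearTriples_le (ε / 2) (by positivity)
  refine ⟨1 + C * (30 + 6 / ε), by positivity, fun K T hK hT => ?_⟩
  have hK' : (1 : ℝ) ≤ K := by exact_mod_cast hK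
  set R : ℕ := (24 * K ^ 3).toNat with hR
  have hRK : (R : ℤ) = 24 * K ^ 3 := Int.toNat_of_nonneg (by positivity)
  have hRK' : (R : ℝ) = 24 * (K : ℝ) ^ 3 := by exact_mod_cast hRK
  have hgap : ∀ T' ∈ triples K, gap T T' ≤ R := fun T' h => by
    have := gap_le K T T' hK hT h
    omega
  rw [Finset.sum_congr rfl fun T' h => one_div_succ_eq_sum _ R (hgap T' h),
    Finset.sum_add_distrib, Finset.sum_comm]
  have first : ∑ T' ∈ triples K, 1 / ((R : ℝ) + 1) ≤ 1 := by
    rw [Finset.sum_const, nsmul_eq_mul, hRK', mul_one_div]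
    have : ((triples K).card : ℝ) = (K : ℝ) ^ 3 := by
      have : ((triples K).card : ℤ) = K ^ 3 := by
        have hc : ((Finset.Ico K (2 * K)).card : ℤ) = K := by rw [Int.card_Ico]; omega
        rw [triples, Finset.card_product, Finset.card_product]
        push_cast
        rw [hc]; ring
      exact_mod_cast this
    rw [this, div_le_one (by positivity)]
    have : 0 < (K : ℝ) ^ 3 := by positivity
    linarith
  have hKe : 1 ≤ (K : ℝ) ^ (ε / 2) := Real.one_le_rpow hK' (by positivity)
  have second : ∀ i ∈ Finset.range R, (∑ T' ∈ triples K,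
      if gap T T' ≤ i then 1 / (((i : ℝ) + 1) * ((i : ℝ) + 2)) else 0) ≤
      C * (K : ℝ) ^ (ε / 2) * (1 / ((i : ℝ) + 1)) := by
    intro i _
    rw [← Finset.sum_filter, Finset.sum_const, nsmul_eq_mul]
    have hsub : ((triples K).filter fun T' => gap T T' ≤ i) ⊆ nearTriples K (i + 1) T := by
      intro T' h
      simp only [nearTriples, gap, Finset.mem_filter, max_le_iff] at h ⊢
      refine ⟨h.1, ?_, ?_, ?_⟩ <;> rw [abs_le] <;> omega
    have h1 : ((((triples K).filter fun T' => gap T T' ≤ i).card : ℕ) : ℝ) ≤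
        C * (K : ℝ) ^ (ε / 2) * ((i : ℝ) + 1) := by
      have := hcount K (i + 1) T hK (by omega) hT
      push_cast at this
      refine le_trans ?_ this
      exact_mod_cast Finset.card_le_card hsub
    calc _ ≤ C * (K : ℝ) ^ (ε / 2) * ((i : ℝ) + 1) * (1 / (((i : ℝ) + 1) * ((i : ℝ) + 2))) :=
          mul_le_mul_of_nonneg_right h1 (by positivity)
      _ = C * (K : ℝ) ^ (ε / 2) * (1 / ((i : ℝ) + 2)) := by field_simp
      _ ≤ _ := by
          refine mul_le_mul_of_nonneg_left ?_ (by positivity)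
          exact one_div_le_one_div_of_le (by positivity) (by linarith)
  have third := Finset.sum_le_sum second
  rw [← Finset.mul_sum] at third
  have hlog : 1 + Real.log R ≤ (30 + 6 / ε) * (K : ℝ) ^ (ε / 2) := by
    rw [hRK', Real.log_mul (by norm_num) (by positivity), Real.log_pow]
    have l1 : Real.log 24 ≤ 23 := by
      have := Real.log_le_sub_one_of_pos (by norm_num : (0 : ℝ) < 24)
      linarith
    have l2 := Real.log_le_rpow_div (by linarith : (0 : ℝ) ≤ K) (by positivity : 0 < ε / 2)
    have l3 : (K : ℝ) ^ (ε / 2) / (ε / 2) = 2 / ε * (K : ℝ) ^ (ε / 2) := by field_simp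
    rw [l3] at l2
    have : (30 + 6 / ε) * (K : ℝ) ^ (ε / 2) =
      30 * (K : ℝ) ^ (ε / 2) + 3 * (2 / ε * (K : ℝ) ^ (ε / 2)) := by ring
    rw [this]
    push_cast
    linarith
  have e : (K : ℝ) ^ ε = (K : ℝ) ^ (ε / 2) * (K : ℝ) ^ (ε / 2) := by
    rw [← Real.rpow_add (by linarith)]; congr 1; ring
  have h5 : C * (K : ℝ) ^ (ε / 2) * ∑ i ∈ Finset.range R, 1 / ((i : ℝ) + 1) ≤
      C * (30 + 6 / ε) * (K : ℝ) ^ ε := by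
    calc _ ≤ C * (K : ℝ) ^ (ε / 2) * ((30 + 6 / ε) * (K : ℝ) ^ (ε / 2)) :=
          mul_le_mul_of_nonneg_left ((sum_inv_succ_le R).trans hlog) (by positivity)
      _ = _ := by rw [e]; ring
  have h6 : 1 ≤ (K : ℝ) ^ ε := Real.one_le_rpow hK' hε.le
  linarith

/-- The linear functional on the plane with the given coefficients. -/
noncomputable def lin (a b : ℝ) : ℝ × ℝ →L[ℝ] ℝ :=
  a • ContinuousLinearMap.fst ℝ ℝ ℝ + b • ContinuousLinearMap.snd ℝ ℝ ℝ

@[simp] lemma lin_apply (a b : ℝ) (v : ℝ × ℝ) : lin a b v = a * v.1 + b * v.2 := by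
  simp [lin]

/-- `φ` is twice continuously differentiable on the square, with gradient `(p, q)` and Hessian
`(r, s; s, t)`. -/
structure HasHessianOnSq (φ p q r s t : ℝ × ℝ → ℝ) : Prop where
  grad : ∀ x ∈ Sq, HasFDerivWithinAt φ (lin (p x) (q x)) Sq x
  fst : ∀ x ∈ Sq, HasFDerivWithinAt p (lin (r x) (s x)) Sq x
  snd : ∀ x ∈ Sq, HasFDerivWithinAt q (lin (s x) (t x)) Sq x
  cont_r : ContinuousOn r Sq
  cont_s : ContinuousOn s Sq
  cont_t : ContinuousOn t Sq

lemma hasDerivAt_e (t : ℝ) : HasDerivAt e (2 * Real.pi * Complex.I * e t) t := by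
  unfold e
  have h : HasDerivAt (fun t : ℝ => 2 * Real.pi * Complex.I * (t : ℂ))
      (2 * Real.pi * Complex.I) t := by
    simpa using (Complex.ofRealCLM.hasDerivAt (x := t)).const_mul (2 * Real.pi * Complex.I)
  refine h.cexp.congr_deriv ?_
  ring

lemma continuous_e : Continuous e :=
  continuous_iff_continuousAt.2 fun t => (hasDerivAt_e t).continuousAt

lemma norm_e (t : ℝ) : ‖e t‖ = 1 := by
  rw [e, show (2 * Real.pi * Complex.I * t : ℂ) = ((2 * Real.pi * t : ℝ) : ℂ) * Complex.I by
    push_cast; ring]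
  exact Complex.norm_exp_ofReal_mul_I _

lemma hasFDerivAt_smul_e {V Φ : ℝ × ℝ → ℝ} {V' Φ' : ℝ × ℝ →L[ℝ] ℝ} {x : ℝ × ℝ}
    (hV : HasFDerivAt V V' x) (hΦ : HasFDerivAt Φ Φ' x) :
    ∃ F' : ℝ × ℝ →L[ℝ] ℂ, HasFDerivAt (fun x => V x • e (Φ x)) F' x ∧
      ∀ v, F' v = ((V' v : ℂ) + 2 * Real.pi * Complex.I * (V x * Φ' v : ℝ)) * e (Φ x) := by
  have h1 : HasFDerivAt (fun x => e (Φ x)) _ x := (hasDerivAt_e (Φ x)).hasFDerivAt.comp x hΦ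
  refine ⟨_, hV.smul h1, fun v => ?_⟩
  simp
  ring

lemma hasFDerivAt_div_form {g₁ g₂ : ℝ × ℝ → ℝ} {κ a b c d : ℝ} {x : ℝ × ℝ} (hκ : 0 < κ)
    (h1 : HasFDerivAt g₁ (lin a b) x) (h2 : HasFDerivAt g₂ (lin c d) x) :
    HasFDerivAt (fun x => g₁ x / (g₁ x ^ 2 + g₂ x ^ 2 + κ))
      (lin (a / (g₁ x ^ 2 + g₂ x ^ 2 + κ) -
          g₁ x * (2 * (g₁ x * a + g₂ x * c)) / (g₁ x ^ 2 + g₂ x ^ 2 + κ) ^ 2)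
        (b / (g₁ x ^ 2 + g₂ x ^ 2 + κ) -
          g₁ x * (2 * (g₁ x * b + g₂ x * d)) / (g₁ x ^ 2 + g₂ x ^ 2 + κ) ^ 2)) x := by
  have hW : g₁ x ^ 2 + g₂ x ^ 2 + κ ≠ 0 := by positivity
  have hd : HasFDerivAt (fun x => g₁ x ^ 2 + g₂ x ^ 2 + κ)
      (lin (2 * (g₁ x * a + g₂ x * c)) (2 * (g₁ x * b + g₂ x * d))) x := by
    have := ((h1.pow 2).add (h2.pow 2)).add_const κ
    refine this.congr_fderiv ?_
    ext <;> simp <;> ring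
  have := h1.mul ((hasDerivAt_inv hW).comp_hasFDerivAt x hd)
  simp only [div_eq_mul_inv]
  refine this.congr_fderiv ?_
  ext <;> simp <;> field_simp <;> ring

/-- The divergence of the vector field used for integrating by parts. -/
lemma abs_div_field_le (g₁ g₂ C r s t κ B : ℝ) (hκ : 0 < κ) (hr : |r| ≤ B) (hs : |s| ≤ B)
    (ht : |t| ≤ B) :
    |((C * r) / (g₁ ^ 2 + g₂ ^ 2 + κ) -
        g₁ * (2 * (g₁ * (C * r) + g₂ * (C * s))) / (g₁ ^ 2 + g₂ ^ 2 + κ) ^ 2) +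
      ((C * t) / (g₁ ^ 2 + g₂ ^ 2 + κ) -
        g₂ * (2 * (g₁ * (C * s) + g₂ * (C * t))) / (g₁ ^ 2 + g₂ ^ 2 + κ) ^ 2)| ≤
      6 * B * |C| / (g₁ ^ 2 + g₂ ^ 2 + κ) := by
  have hB : 0 ≤ B := (abs_nonneg r).trans hr
  set W := g₁ ^ 2 + g₂ ^ 2 + κ with hW
  have hW0 : 0 < W := by positivity
  have key : ((C * r) / W - g₁ * (2 * (g₁ * (C * r) + g₂ * (C * s))) / W ^ 2) +
      ((C * t) / W - g₂ * (2 * (g₁ * (C * s) + g₂ * (C * t))) / W ^ 2) =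
      C * ((r + t) * W - 2 * (g₁ ^ 2 * r + 2 * (g₁ * g₂) * s + g₂ ^ 2 * t)) / W ^ 2 := by
    field_simp; ring
  rw [key, abs_div, abs_mul, abs_of_pos (pow_pos hW0 2), div_le_div_iff₀ (by positivity) hW0]
  have h1 : |(r + t) * W| ≤ 2 * B * W := by
    rw [abs_mul, abs_of_pos hW0]
    exact mul_le_mul_of_nonneg_right ((abs_add_le _ _).trans (by linarith)) hW0.le
  have h2 : |g₁ ^ 2 * r| ≤ g₁ ^ 2 * B := by
    rw [abs_mul, abs_of_nonneg (sq_nonneg _)]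
    exact mul_le_mul_of_nonneg_left hr (sq_nonneg _)
  have h3 : |g₂ ^ 2 * t| ≤ g₂ ^ 2 * B := by
    rw [abs_mul, abs_of_nonneg (sq_nonneg _)]
    exact mul_le_mul_of_nonneg_left ht (sq_nonneg _)
  have h4 : |2 * (g₁ * g₂) * s| ≤ (g₁ ^ 2 + g₂ ^ 2) * B := by
    rw [abs_mul]
    refine mul_le_mul ?_ hs (abs_nonneg _) (by positivity)
    rw [abs_le]
    constructor <;> nlinarith [sq_nonneg (g₁ + g₂), sq_nonneg (g₁ - g₂)]
  have h5 : (g₁ ^ 2 + g₂ ^ 2) * B ≤ W * B :=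
    mul_le_mul_of_nonneg_right (by rw [hW]; linarith) hB
  have h6 : |(r + t) * W - 2 * (g₁ ^ 2 * r + 2 * (g₁ * g₂) * s + g₂ ^ 2 * t)| ≤ 6 * B * W := by
    rw [abs_le] at *
    constructor <;> linarith
  calc |C| * |(r + t) * W - 2 * (g₁ ^ 2 * r + 2 * (g₁ * g₂) * s + g₂ ^ 2 * t)| * W
      ≤ |C| * (6 * B * W) * W := by gcongr
    _ = _ := by ring

lemma HasHessianOnSq.hasFDerivAt_of_interior {φ : ℝ × ℝ → ℝ} {L : ℝ × ℝ →L[ℝ] ℝ} {a b x : ℝ × ℝ}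
    (hI : Set.Icc a b ⊆ Sq) (hx : x ∈ Set.Ioo a.1 b.1 ×ˢ Set.Ioo a.2 b.2)
    (h : HasFDerivWithinAt φ L Sq x) : HasFDerivAt φ L x := by
  refine h.hasFDerivAt (Filter.mem_of_superset
    ((isOpen_Ioo.prod isOpen_Ioo).mem_nhds hx) (subset_trans ?_ hI))
  intro y hy
  exact ⟨⟨hy.1.1.le, hy.2.1.le⟩, ⟨hy.1.2.le, hy.2.2.le⟩⟩

section

variable {φ p q r s t : ℝ × ℝ → ℝ}

lemma abs_div_le_one_div_sqrt {g W : ℝ} (hW : 0 < W) (h : g ^ 2 ≤ W) : |g / W| ≤ 1 / √W := by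
  rw [abs_div, abs_of_pos hW, div_le_div_iff₀ hW (Real.sqrt_pos.2 hW), one_mul]
  calc |g| * √W ≤ √W * √W := mul_le_mul_of_nonneg_right (Real.abs_le_sqrt h) (Real.sqrt_nonneg _)
    _ = W := Real.mul_self_sqrt hW.le

lemma norm_intervalIntegral_le_mul {f : ℝ → ℂ} {h : ℝ → ℝ} {a b M J : ℝ} (hab : a ≤ b)
    (hc : Continuous h) (hM : 0 ≤ M) (hf : ∀ x ∈ Set.Icc a b, ‖f x‖ ≤ M * h x)
    (hJ : ∫ x in a..b, h x ≤ J) : ‖∫ x in a..b, f x‖ ≤ M * J := by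
  calc _ ≤ ∫ x in a..b, M * h x := by
        refine intervalIntegral.norm_integral_le_of_norm_le hab
          (Filter.Eventually.of_forall fun x hx => hf x (Set.Ioc_subset_Icc_self hx))
          ((continuous_const.mul hc).intervalIntegrable _ _)
    _ = M * ∫ x in a..b, h x := intervalIntegral.integral_const_mul _ _
    _ ≤ _ := mul_le_mul_of_nonneg_left hJ hM

/-- Integration by parts for an oscillatory integral over a rectangle. -/
lemma HasHessianOnSq.norm_integral_le (H : HasHessianOnSq φ p q r s t) {a b : ℝ × ℝ} (hab : a ≤ b)
    (hI : Set.Icc a b ⊆ Sq) (A B C κ B₀ : ℝ) (hκ : 0 < κ) (hr : ∀ x ∈ Sq, |r x| ≤ B₀)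
    (hs : ∀ x ∈ Sq, |s x| ≤ B₀) (ht : ∀ x ∈ Sq, |t x| ≤ B₀) (h₁ h₂ : ℝ → ℝ)
    (hc₁ : Continuous h₁) (hc₂ : Continuous h₂) (hp₁ : ∀ x, 0 ≤ h₁ x) (hp₂ : ∀ x, 0 ≤ h₂ x)
    (M J : ℝ) (hM : 0 ≤ M)
    (hW₁ : ∀ x ∈ Set.Icc a b, 1 / √((A + C * p x) ^ 2 + (B + C * q x) ^ 2 + κ) ≤ M * h₁ x.1)
    (hW₂ : ∀ x ∈ Set.Icc a b, 1 / √((A + C * p x) ^ 2 + (B + C * q x) ^ 2 + κ) ≤ M * h₂ x.2)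
    (hJ₁ : ∫ x in a.1..b.1, h₁ x ≤ J) (hJ₂ : ∫ x in a.2..b.2, h₂ x ≤ J) :
    ‖∫ x in Set.Icc a b, e (A * x.1 + B * x.2 + C * φ x)‖ ≤
      4 * (M * J) + (6 * B₀ * |C| + 2 * Real.pi * κ) * (M * J) ^ 2 := by
  set Φ : ℝ × ℝ → ℝ := fun x => A * x.1 + B * x.2 + C * φ x with hΦ
  set g₁ : ℝ × ℝ → ℝ := fun x => A + C * p x with hg₁
  set g₂ : ℝ × ℝ → ℝ := fun x => B + C * q x with hg₂
  set W : ℝ × ℝ → ℝ := fun x => g₁ x ^ 2 + g₂ x ^ 2 + κ with hW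
  have hW0 : ∀ x, 0 < W x := fun x => by simp only [hW]; positivity
  have cφ : ContinuousOn φ (Set.Icc a b) := fun x hx =>
    ((H.grad x (hI hx)).continuousWithinAt).mono hI
  have cp : ContinuousOn p (Set.Icc a b) := fun x hx =>
    ((H.fst x (hI hx)).continuousWithinAt).mono hI
  have cq : ContinuousOn q (Set.Icc a b) := fun x hx =>
    ((H.snd x (hI hx)).continuousWithinAt).mono hI
  have cr := H.cont_r.mono hI
  have cs := H.cont_s.mono hI
  have ct := H.cont_t.mono hI
  have cΦ : ContinuousOn Φ (Set.Icc a b) := by fun_prop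
  have cg₁ : ContinuousOn g₁ (Set.Icc a b) := by fun_prop
  have cg₂ : ContinuousOn g₂ (Set.Icc a b) := by fun_prop
  have cW : ContinuousOn W (Set.Icc a b) := by fun_prop
  have ce : ContinuousOn (fun x => e (Φ x)) (Set.Icc a b) := continuous_e.comp_continuousOn cΦ
  have cV₁ : ContinuousOn (fun x => g₁ x / W x) (Set.Icc a b) :=
    cg₁.div cW fun x _ => (hW0 x).ne'
  have cV₂ : ContinuousOn (fun x => g₂ x / W x) (Set.Icc a b) :=
    cg₂.div cW fun x _ => (hW0 x).ne'
  set D : ℝ × ℝ → ℝ := fun x =>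
    ((C * r x) / W x - g₁ x * (2 * (g₁ x * (C * r x) + g₂ x * (C * s x))) / W x ^ 2) +
      ((C * t x) / W x - g₂ x * (2 * (g₁ x * (C * s x) + g₂ x * (C * t x))) / W x ^ 2) with hD
  have cD : ContinuousOn D (Set.Icc a b) := by
    have := fun x (_ : x ∈ Set.Icc a b) => (hW0 x).ne'
    have := fun x (_ : x ∈ Set.Icc a b) => (pow_pos (hW0 x) 2).ne'
    simp only [hD]
    refine ((ContinuousOn.div ?_ cW ?_).sub (ContinuousOn.div ?_ (cW.pow 2) ?_)).add
      ((ContinuousOn.div ?_ cW ?_).sub (ContinuousOn.div ?_ (cW.pow 2) ?_))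
    all_goals first | assumption | fun_prop
  set F₁ : ℝ × ℝ → ℂ := fun x => (g₁ x / W x) • e (Φ x) with hF₁
  set F₂ : ℝ × ℝ → ℂ := fun x => (g₂ x / W x) • e (Φ x) with hF₂
  have nF₁ : ∀ x, ‖F₁ x‖ ≤ 1 / √(W x) := fun x => by
    simp only [hF₁]
    rw [norm_smul, norm_e, mul_one]
    exact abs_div_le_one_div_sqrt (hW0 x) (by simp only [hW]; nlinarith [sq_nonneg (g₂ x)])
  have nF₂ : ∀ x, ‖F₂ x‖ ≤ 1 / √(W x) := fun x => by
    simp only [hF₂]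
    rw [norm_smul, norm_e, mul_one]
    exact abs_div_le_one_div_sqrt (hW0 x) (by simp only [hW]; nlinarith [sq_nonneg (g₁ x)])
  have deriv : ∀ x ∈ Set.Ioo a.1 b.1 ×ˢ Set.Ioo a.2 b.2,
      ∃ F' G' : ℝ × ℝ →L[ℝ] ℂ, HasFDerivAt F₁ F' x ∧ HasFDerivAt F₂ G' x ∧
        F' (1, 0) + G' (0, 1) =
          ((D x : ℂ) + 2 * Real.pi * Complex.I * (1 - κ / W x : ℝ)) * e (Φ x) := by
    intro x hx
    have hx' : x ∈ Sq := hI ⟨⟨hx.1.1.le, hx.2.1.le⟩, ⟨hx.1.2.le, hx.2.2.le⟩⟩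
    have dφ := HasHessianOnSq.hasFDerivAt_of_interior hI hx (H.grad x hx')
    have dp := HasHessianOnSq.hasFDerivAt_of_interior hI hx (H.fst x hx')
    have dq := HasHessianOnSq.hasFDerivAt_of_interior hI hx (H.snd x hx')
    have d₁ : HasFDerivAt g₁ (lin (C * r x) (C * s x)) x := by
      refine ((dp.const_mul C).const_add A).congr_fderiv ?_
      ext <;> simp
    have d₂ : HasFDerivAt g₂ (lin (C * s x) (C * t x)) x := by
      refine ((dq.const_mul C).const_add B).congr_fderiv ?_
      ext <;> simp
    have dΦ : HasFDerivAt Φ (lin (g₁ x) (g₂ x)) x := by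
      have := ((hasFDerivAt_fst.const_mul A).add (hasFDerivAt_snd.const_mul B)).add
        (dφ.const_mul C)
      refine this.congr_fderiv ?_
      ext <;> simp [hg₁, hg₂]
    have e₁ := hasFDerivAt_div_form hκ d₁ d₂
    have e₂ := hasFDerivAt_div_form hκ d₂ d₁
    simp only [add_comm (g₂ _ ^ 2) (g₁ _ ^ 2)] at e₂
    obtain ⟨F', hF', vF'⟩ := hasFDerivAt_smul_e e₁ dΦ
    obtain ⟨G', hG', vG'⟩ := hasFDerivAt_smul_e e₂ dΦ
    refine ⟨F', G', hF', hG', ?_⟩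
    rw [vF', vG', ← add_mul]
    congr 1
    simp only [lin_apply, mul_one, mul_zero, add_zero, zero_add]
    have hk : 1 - κ / W x = g₁ x / W x * g₁ x + g₂ x / W x * g₂ x := by
      have := (hW0 x).ne'
      field_simp
      simp only [hW]
      ring
    rw [hk]
    simp only [hD, hW]
    push_cast
    ring
  choose! F' G' hF' hG' hFG using deriv
  have cI : ContinuousOn (fun x => ((D x : ℂ) + 2 * Real.pi * Complex.I * (1 - κ / W x : ℝ)) *
      e (Φ x)) (Set.Icc a b) := by
    have : ContinuousOn (fun x => κ / W x) (Set.Icc a b) :=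
      continuousOn_const.div cW fun x _ => (hW0 x).ne'
    refine ContinuousOn.mul (ContinuousOn.add (Complex.continuous_ofReal.comp_continuousOn cD)
      (continuousOn_const.mul (Complex.continuous_ofReal.comp_continuousOn ?_))) ce
    exact continuousOn_const.sub this
  have hopen : ∀ f g : ℝ × ℝ → ℂ, (∀ x ∈ Set.Ioo a.1 b.1 ×ˢ Set.Ioo a.2 b.2, f x = g x) →
      f =ᵐ[volume.restrict (Set.Icc a b)] g := by
    intro f g hfg
    have hae : (Set.Ioo a.1 b.1 ×ˢ Set.Ioo a.2 b.2 : Set (ℝ × ℝ)) =ᵐ[volume] Set.Icc a b := by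
      rw [← Prod.mk.eta (p := a), ← Prod.mk.eta (p := b), ← Set.Icc_prod_Icc]
      exact Measure.set_prod_ae_eq Ioo_ae_eq_Icc Ioo_ae_eq_Icc
    rw [← Measure.restrict_congr_set hae]
    exact (ae_restrict_iff' (measurableSet_Ioo.prod measurableSet_Ioo)).2
      (Filter.Eventually.of_forall hfg)
  have hae := hopen _ _ hFG
  have div := integral_divergence_prod_Icc_of_hasFDerivAt_of_le F₁ F₂ F' G' a b hab
    (cV₁.smul ce) (cV₂.smul ce) hF' hG'
    ((integrable_congr hae).2 (cI.integrableOn_compact isCompact_Icc))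
  rw [integral_congr_ae hae] at div
  have k1 : ∀ x ∈ Set.Icc a.1 b.1, ∀ y ∈ Set.Icc a.2 b.2, (x, y) ∈ Set.Icc a b :=
    fun x hx y hy => ⟨⟨hx.1, hy.1⟩, ⟨hx.2, hy.2⟩⟩
  have b1 : ‖∫ x in a.1..b.1, F₂ (x, b.2)‖ ≤ M * J :=
    norm_intervalIntegral_le_mul hab.1 hc₁ hM
      (fun x hx => (nF₂ _).trans (hW₁ _ (k1 x hx b.2 ⟨hab.2, le_rfl⟩))) hJ₁
  have b2 : ‖∫ x in a.1..b.1, F₂ (x, a.2)‖ ≤ M * J :=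
    norm_intervalIntegral_le_mul hab.1 hc₁ hM
      (fun x hx => (nF₂ _).trans (hW₁ _ (k1 x hx a.2 ⟨le_rfl, hab.2⟩))) hJ₁
  have b3 : ‖∫ y in a.2..b.2, F₁ (b.1, y)‖ ≤ M * J :=
    norm_intervalIntegral_le_mul hab.2 hc₂ hM
      (fun y hy => (nF₁ _).trans (hW₂ _ (k1 b.1 ⟨hab.1, le_rfl⟩ y hy))) hJ₂
  have b4 : ‖∫ y in a.2..b.2, F₁ (a.1, y)‖ ≤ M * J :=
    norm_intervalIntegral_le_mul hab.2 hc₂ hM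
      (fun y hy => (nF₁ _).trans (hW₂ _ (k1 a.1 ⟨le_rfl, hab.1⟩ y hy))) hJ₂
  have hB₀ : 0 ≤ B₀ := (abs_nonneg _).trans (hr a (hI ⟨le_rfl, hab⟩))
  have cR : ContinuousOn (fun x => ((D x : ℂ) - 2 * Real.pi * Complex.I * (κ / W x : ℝ)) *
      e (Φ x)) (Set.Icc a b) := by
    have : ContinuousOn (fun x => κ / W x) (Set.Icc a b) :=
      continuousOn_const.div cW fun x _ => (hW0 x).ne'
    exact ContinuousOn.mul (ContinuousOn.sub (Complex.continuous_ofReal.comp_continuousOn cD)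
      (continuousOn_const.mul (Complex.continuous_ofReal.comp_continuousOn this))) ce
  have split : (∫ x in Set.Icc a b,
      ((D x : ℂ) + 2 * Real.pi * Complex.I * (1 - κ / W x : ℝ)) * e (Φ x)) =
      (∫ x in Set.Icc a b, ((D x : ℂ) - 2 * Real.pi * Complex.I * (κ / W x : ℝ)) * e (Φ x)) +
      2 * Real.pi * Complex.I * ∫ x in Set.Icc a b, e (Φ x) := by
    have cE : ContinuousOn (fun x => 2 * Real.pi * Complex.I * e (Φ x)) (Set.Icc a b) :=
      continuousOn_const.mul ce
    rw [← integral_const_mul, ← integral_add (cR.integrableOn_compact isCompact_Icc)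
      (cE.integrableOn_compact isCompact_Icc)]
    refine integral_congr_ae (Filter.Eventually.of_forall fun x => ?_)
    simp only
    push_cast
    ring
  have bR : ‖∫ x in Set.Icc a b, ((D x : ℂ) - 2 * Real.pi * Complex.I * (κ / W x : ℝ)) * e (Φ x)‖
      ≤ (6 * B₀ * |C| + 2 * Real.pi * κ) * (M * J) ^ 2 := by
    have hbound : ∀ x ∈ Set.Icc a b,
        ‖((D x : ℂ) - 2 * Real.pi * Complex.I * (κ / W x : ℝ)) * e (Φ x)‖ ≤
        (6 * B₀ * |C| + 2 * Real.pi * κ) * M ^ 2 * (h₁ x.1 * h₂ x.2) := by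
      intro x hx
      rw [norm_mul, norm_e, mul_one]
      have i1 : |D x| ≤ 6 * B₀ * |C| / W x := abs_div_field_le (g₁ x) (g₂ x) C (r x) (s x) (t x)
        κ B₀ hκ (hr x (hI hx)) (hs x (hI hx)) (ht x (hI hx))
      have i2 : ‖(2 * Real.pi * Complex.I * (κ / W x : ℝ) : ℂ)‖ = 2 * Real.pi * κ / W x := by
        rw [norm_mul, norm_mul, norm_mul, Complex.norm_I, Complex.norm_real, Complex.norm_real,
          Real.norm_of_nonneg Real.pi_pos.le, Real.norm_of_nonneg (by have := hW0 x; positivity)]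
        simp
        ring
      have i3 : 1 / W x ≤ M ^ 2 * (h₁ x.1 * h₂ x.2) := by
        have : 1 / W x = (1 / √(W x)) * (1 / √(W x)) := by
          rw [div_mul_div_comm, one_mul, Real.mul_self_sqrt (hW0 x).le]
        rw [this]
        calc _ ≤ (M * h₁ x.1) * (M * h₂ x.2) := mul_le_mul (hW₁ x hx) (hW₂ x hx)
              (by positivity) (mul_nonneg hM (hp₁ _))
          _ = _ := by ring
      calc _ ≤ ‖(D x : ℂ)‖ + ‖(2 * Real.pi * Complex.I * (κ / W x : ℝ) : ℂ)‖ := norm_sub_le _ _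
        _ ≤ 6 * B₀ * |C| / W x + 2 * Real.pi * κ / W x := by
            rw [i2, Complex.norm_real, Real.norm_eq_abs]; linarith
        _ = (6 * B₀ * |C| + 2 * Real.pi * κ) * (1 / W x) := by ring
        _ ≤ (6 * B₀ * |C| + 2 * Real.pi * κ) * (M ^ 2 * (h₁ x.1 * h₂ x.2)) :=
            mul_le_mul_of_nonneg_left i3 (by positivity)
        _ = _ := by ring
    have ch : Continuous fun x : ℝ × ℝ =>
        (6 * B₀ * |C| + 2 * Real.pi * κ) * M ^ 2 * (h₁ x.1 * h₂ x.2) := by fun_prop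
    refine (norm_integral_le_of_norm_le (ch.continuousOn.integrableOn_compact isCompact_Icc)
      ((ae_restrict_iff' measurableSet_Icc).2 (Filter.Eventually.of_forall hbound))).trans ?_
    rw [integral_const_mul]
    have hprod : ∫ x in Set.Icc a b, h₁ x.1 * h₂ x.2 =
        (∫ x in a.1..b.1, h₁ x) * ∫ y in a.2..b.2, h₂ y := by
      rw [intervalIntegral.integral_of_le hab.1, intervalIntegral.integral_of_le hab.2,
        ← integral_Icc_eq_integral_Ioc, ← integral_Icc_eq_integral_Ioc, ← setIntegral_prod_mul,
        Set.Icc_prod_Icc]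
      rfl
    rw [hprod]
    have j1 : 0 ≤ ∫ x in a.1..b.1, h₁ x :=
      intervalIntegral.integral_nonneg hab.1 fun x _ => hp₁ x
    have j2 : 0 ≤ ∫ x in a.2..b.2, h₂ x :=
      intervalIntegral.integral_nonneg hab.2 fun x _ => hp₂ x
    calc _ ≤ (6 * B₀ * |C| + 2 * Real.pi * κ) * M ^ 2 * (J * J) :=
          mul_le_mul_of_nonneg_left (mul_le_mul hJ₁ hJ₂ j2 (j1.trans hJ₁)) (by positivity)
      _ = _ := by ring
  rw [split] at div
  have main : 2 * Real.pi * ‖∫ x in Set.Icc a b, e (Φ x)‖ ≤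
      4 * (M * J) + (6 * B₀ * |C| + 2 * Real.pi * κ) * (M * J) ^ 2 := by
    have n : 2 * Real.pi * ‖∫ x in Set.Icc a b, e (Φ x)‖ =
        ‖2 * Real.pi * Complex.I * ∫ x in Set.Icc a b, e (Φ x)‖ := by
      rw [norm_mul, norm_mul, norm_mul, Complex.norm_I, Complex.norm_real,
        Real.norm_of_nonneg Real.pi_pos.le]
      simp
    rw [n, eq_sub_of_add_eq' div]
    refine (norm_sub_le _ _).trans (add_le_add ?_ bR)
    refine (norm_sub_le _ _).trans ?_
    have := (norm_add_le ((∫ x in a.1..b.1, F₂ (x, b.2)) - ∫ x in a.1..b.1, F₂ (x, a.2))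
      (∫ y in a.2..b.2, F₁ (b.1, y)))
    have := norm_sub_le (∫ x in a.1..b.1, F₂ (x, b.2)) (∫ x in a.1..b.1, F₂ (x, a.2))
    linarith
  have : 1 ≤ 2 * Real.pi := by linarith [Real.pi_gt_three]
  calc _ ≤ 2 * Real.pi * ‖∫ x in Set.Icc a b, e (Φ x)‖ := le_mul_of_one_le_left (norm_nonneg _) this
    _ ≤ _ := main

lemma mem_Sq {x : ℝ × ℝ} : x ∈ Sq ↔ (-1 ≤ x.1 ∧ x.1 ≤ 1) ∧ (-1 ≤ x.2 ∧ x.2 ≤ 1) := Iff.rfl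

lemma isCompact_Sq : IsCompact Sq := isCompact_Icc.prod isCompact_Icc

lemma convex_Sq : Convex ℝ Sq := (convex_Icc _ _).prod (convex_Icc _ _)

lemma dist_le_of_mem_segment {x y z : ℝ × ℝ} (hz : z ∈ segment ℝ x y) : dist z x ≤ dist x y := by
  have h := (convex_closedBall x (dist x y)).segment_subset (Metric.mem_closedBall_self dist_nonneg)
    (by rw [Metric.mem_closedBall, dist_comm]) hz
  exact h

lemma abs_le_of_cramer {α β γ' δ' u v P Q B ε : ℝ} (hP : P = α * u + β * v)
    (hQ : Q = γ' * u + δ' * v) (hdet : ε ≤ |α * δ' - β * γ'|) (hα : |α| ≤ B)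
    (hβ : |β| ≤ B) (hγ : |γ'| ≤ B) (hδ : |δ'| ≤ B) :
    ε / (2 * B + 1) * max |u| |v| ≤ max |P| |Q| := by
  have hB : 0 ≤ B := (abs_nonneg _).trans hα
  have aux : ∀ w x y : ℝ, |x| ≤ B → |y| ≤ B → (α * δ' - β * γ') * w = x * P - y * Q →
      ε * |w| ≤ (2 * B + 1) * max |P| |Q| := by
    intro w x y hx hy h
    calc ε * |w| ≤ |α * δ' - β * γ'| * |w| := mul_le_mul_of_nonneg_right hdet (abs_nonneg _)
      _ = |x * P - y * Q| := by rw [← abs_mul, h]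
      _ ≤ |x * P| + |y * Q| := abs_sub _ _
      _ ≤ B * max |P| |Q| + B * max |P| |Q| := by
          rw [abs_mul, abs_mul]
          exact add_le_add (mul_le_mul hx (le_max_left _ _) (abs_nonneg _) hB)
            (mul_le_mul hy (le_max_right _ _) (abs_nonneg _) hB)
      _ ≤ _ := by have : 0 ≤ max |P| |Q| := (abs_nonneg _).trans (le_max_left _ _)
                  linarith
  rw [div_mul_eq_mul_div, div_le_iff₀ (by positivity), mul_comm (max |P| |Q|)]
  rcases max_choice |u| |v| with h | h <;> rw [h]
  · exact aux u δ' β hδ hβ (by rw [hP, hQ]; ring)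
  · refine aux v (-γ') (-α) (by rwa [abs_neg]) (by rwa [abs_neg]) (by rw [hP, hQ]; ring)

/-- Where the Hessian is nondegenerate, the gradient is locally expanding. -/
lemma HasHessianOnSq.exists_le_gradient_sub (H : HasHessianOnSq φ p q r s t) {B ε : ℝ} (hε : 0 < ε)
    (hr : ∀ x ∈ Sq, |r x| ≤ B) (hs : ∀ x ∈ Sq, |s x| ≤ B) (ht : ∀ x ∈ Sq, |t x| ≤ B)
    (hdet : ∀ x ∈ Sq, ε ≤ |r x * t x - s x ^ 2|) :
    ∃ δ > 0, ∃ c > 0, ∀ x ∈ Sq, ∀ y ∈ Sq, dist x y < δ →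
      c * dist x y ≤ max |p y - p x| |q y - q x| := by
  have hB : 0 ≤ B := (abs_nonneg _).trans (hr (0, 0) (by simp [mem_Sq]))
  have cont : ContinuousOn (fun z : (ℝ × ℝ) × (ℝ × ℝ) => r z.1 * t z.2 - s z.1 * s z.2)
      (Sq ×ˢ Sq) := by
    have m1 : Set.MapsTo (Prod.fst : (ℝ × ℝ) × (ℝ × ℝ) → ℝ × ℝ) (Sq ×ˢ Sq) Sq := fun z hz => hz.1
    have m2 : Set.MapsTo (Prod.snd : (ℝ × ℝ) × (ℝ × ℝ) → ℝ × ℝ) (Sq ×ˢ Sq) Sq := fun z hz => hz.2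
    exact ((H.cont_r.comp continuousOn_fst m1).mul (H.cont_t.comp continuousOn_snd m2)).sub
      ((H.cont_s.comp continuousOn_fst m1).mul (H.cont_s.comp continuousOn_snd m2))
  have unif := (isCompact_Sq.prod isCompact_Sq).uniformContinuousOn_of_continuous cont
  obtain ⟨δ, hδ, hunif⟩ := Metric.uniformContinuousOn_iff.1 unif (ε / 2) (by positivity)
  refine ⟨δ, hδ, ε / 2 / (2 * B + 1), by positivity, fun x hx y hy hxy => ?_⟩
  obtain ⟨z, hz, ez⟩ := domain_mvt H.fst convex_Sq hx hy
  obtain ⟨w, hw, ew⟩ := domain_mvt H.snd convex_Sq hx hy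
  have hz' := convex_Sq.segment_subset hx hy hz
  have hw' := convex_Sq.segment_subset hx hy hw
  rw [lin_apply] at ez ew
  have hclose := hunif (z, w) ⟨hz', hw'⟩ (x, x) ⟨hx, hx⟩ (by
    rw [Prod.dist_eq]
    exact max_lt ((dist_le_of_mem_segment hz).trans_lt hxy)
      ((dist_le_of_mem_segment hw).trans_lt hxy))
  rw [Real.dist_eq] at hclose
  dsimp only at hclose
  have hd : ε / 2 ≤ |r z * t w - s z * s w| := by
    have h1 := hdet x hx
    have h2 := abs_sub_abs_le_abs_sub (r x * t x - s x * s x) (r z * t w - s z * s w)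
    rw [abs_sub_comm] at hclose
    rw [sq] at h1
    linarith
  have hdist : dist x y = max |(y - x).1| |(y - x).2| := by
    rw [dist_comm, Prod.dist_eq, Real.dist_eq, Real.dist_eq]; rfl
  rw [hdist]
  exact abs_le_of_cramer ez ew hd (hr z hz') (hs z hz') (hs w hw') (ht w hw')

lemma integral_one_div_sqrt_le (a b x₀ κ : ℝ) (hκ : 0 < κ) (ha : |a - x₀| ≤ 2) (hb : |b - x₀| ≤ 2) :
    ∫ x in a..b, 1 / √((x - x₀) ^ 2 + 1 / κ) ≤ 2 * Real.arsinh (2 * √κ) := by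
  have hd : ∀ x ∈ Set.uIcc a b, HasDerivAt (fun x => Real.arsinh (√κ * (x - x₀)))
      (1 / √((x - x₀) ^ 2 + 1 / κ)) x := by
    intro x _
    have h1 : HasDerivAt (fun x => √κ * (x - x₀)) (√κ) x := by
      simpa using ((hasDerivAt_id x).sub_const x₀).const_mul (√κ)
    refine h1.arsinh.congr_deriv ?_
    have : (x - x₀) ^ 2 + 1 / κ = (1 + (√κ * (x - x₀)) ^ 2) / κ := by
      rw [mul_pow, Real.sq_sqrt hκ.le]; field_simp; ring
    rw [this, Real.sqrt_div (by positivity), one_div_div]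
    simp [div_eq_mul_inv, mul_comm]
  rw [intervalIntegral.integral_eq_sub_of_hasDerivAt hd]
  · have hk := Real.sqrt_nonneg κ
    have h1 : Real.arsinh (√κ * (b - x₀)) ≤ Real.arsinh (2 * √κ) :=
      Real.arsinh_le_arsinh.2 (by nlinarith [(abs_le.1 hb).2])
    have h2 : Real.arsinh (-(2 * √κ)) ≤ Real.arsinh (√κ * (a - x₀)) :=
      Real.arsinh_le_arsinh.2 (by nlinarith [(abs_le.1 ha).1])
    rw [Real.arsinh_neg] at h2
    linarith
  · refine Continuous.intervalIntegrable ?_ _ _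
    refine continuous_const.div (by fun_prop) fun x => ?_
    positivity

lemma arsinh_le_rpow (η : ℝ) (hη : 0 < η) (κ : ℝ) (hκ : 0 ≤ κ) :
    Real.arsinh (2 * √κ) ≤ 5 ^ η / η * (1 + κ) ^ η := by
  have h0 := Real.sqrt_nonneg κ
  have h1 : √κ ≤ 1 + κ := by
    have := Real.sq_sqrt hκ
    nlinarith [sq_nonneg (√κ - 1)]
  have h2 : √(1 + (2 * √κ) ^ 2) ≤ 1 + 2 * √κ := by
    rw [Real.sqrt_le_left (by positivity)]
    nlinarith
  calc Real.arsinh (2 * √κ) ≤ Real.log (5 * (1 + κ)) := by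
        rw [Real.arsinh]
        exact Real.log_le_log (by positivity) (by linarith)
    _ ≤ (5 * (1 + κ)) ^ η / η := Real.log_le_rpow_div (by positivity) hη
    _ = _ := by rw [Real.mul_rpow (by norm_num) (by positivity)]; ring

lemma integral_one_le {a b : ℝ × ℝ} (hab : a ≤ b) (hI : Set.Icc a b ⊆ Sq) :
    (∫ _ in a.1..b.1, (1 : ℝ) ≤ 2) ∧ ∫ _ in a.2..b.2, (1 : ℝ) ≤ 2 := by
  have h1 := mem_Sq.1 (hI (Set.left_mem_Icc.2 hab))
  have h2 := mem_Sq.1 (hI (Set.right_mem_Icc.2 hab))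
  simp only [intervalIntegral.integral_const, smul_eq_mul, mul_one]
  constructor <;> linarith

lemma HasHessianOnSq.norm_integral_le_trivial (H : HasHessianOnSq φ p q r s t) {a b : ℝ × ℝ}
    (hab : a ≤ b) (hI : Set.Icc a b ⊆ Sq) (A B C B₀ : ℝ) (hr : ∀ x ∈ Sq, |r x| ≤ B₀)
    (hs : ∀ x ∈ Sq, |s x| ≤ B₀) (ht : ∀ x ∈ Sq, |t x| ≤ B₀) (M : ℝ) (hM : 0 ≤ M)
    (hW : ∀ x ∈ Set.Icc a b, 1 / √((A + C * p x) ^ 2 + (B + C * q x) ^ 2 + 1) ≤ M) :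
    ‖∫ x in Set.Icc a b, e (A * x.1 + B * x.2 + C * φ x)‖ ≤
      8 * M + 4 * (6 * B₀ * |C| + 2 * Real.pi) * M ^ 2 := by
  have := H.norm_integral_le hab hI A B C 1 B₀ one_pos hr hs ht (fun _ => 1) (fun _ => 1)
    continuous_const continuous_const (fun _ => zero_le_one) (fun _ => zero_le_one) M 2 hM
    (by simpa using hW) (by simpa using hW) (integral_one_le hab hI).1 (integral_one_le hab hI).2
  refine this.trans (le_of_eq ?_)
  ring

lemma HasHessianOnSq.norm_integral_le_of_linear (H : HasHessianOnSq φ p q r s t) {a b : ℝ × ℝ}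
    (hab : a ≤ b) (hI : Set.Icc a b ⊆ Sq) (A B C B₀ m : ℝ)
    (hp : ∀ x ∈ Sq, |p x| ≤ B₀) (hq : ∀ x ∈ Sq, |q x| ≤ B₀) (hr : ∀ x ∈ Sq, |r x| ≤ B₀)
    (hs : ∀ x ∈ Sq, |s x| ≤ B₀) (ht : ∀ x ∈ Sq, |t x| ≤ B₀) (hm : m = max |A| |B|) (hm1 : 1 ≤ m)
    (hC : 4 * B₀ * |C| ≤ m) :
    ‖∫ x in Set.Icc a b, e (A * x.1 + B * x.2 + C * φ x)‖ ≤ 200 / m := by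
  have hm0 : 0 < m := by linarith
  have far : ∀ A f : ℝ, |f| ≤ B₀ → |A| = m → m / 2 ≤ |A + C * f| := by
    intro A f hf hA
    have h1 := abs_sub_abs_le_abs_sub A (-(C * f))
    rw [abs_neg, sub_neg_eq_add, abs_mul] at h1
    have : |C| * |f| ≤ |C| * B₀ := mul_le_mul_of_nonneg_left hf (abs_nonneg _)
    linarith
  have := H.norm_integral_le_trivial hab hI A B C B₀ hr hs ht (2 / m) (by positivity) (by
    intro x hx
    rw [div_le_div_iff₀ (Real.sqrt_pos.2 (by positivity)) hm0, one_mul]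
    have : (m / 2) ^ 2 ≤ (A + C * p x) ^ 2 + (B + C * q x) ^ 2 + 1 := by
      rcases max_choice |A| |B| with h | h
      · have := far A (p x) (hp x (hI hx)) (by rw [hm, h])
        rw [← sq_abs (A + C * p x)]
        nlinarith [sq_nonneg (B + C * q x)]
      · have := far B (q x) (hq x (hI hx)) (by rw [hm, h])
        rw [← sq_abs (B + C * q x)]
        nlinarith [sq_nonneg (A + C * p x)]
    have := Real.le_sqrt_of_sq_le this
    linarith)
  refine this.trans ?_
  have hpi := Real.pi_lt_four
  have hle : 6 * B₀ * |C| + 2 * Real.pi ≤ 10 * m := by linarith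
  calc 8 * (2 / m) + 4 * (6 * B₀ * |C| + 2 * Real.pi) * (2 / m) ^ 2
      ≤ 8 * (2 / m) + 4 * (10 * m) * (2 / m) ^ 2 := by gcongr
    _ = 176 / m := by field_simp; norm_num
    _ ≤ 200 / m := by gcongr; norm_num

lemma HasHessianOnSq.norm_integral_le_of_curved (H : HasHessianOnSq φ p q r s t) {a b : ℝ × ℝ}
    (hab : a ≤ b) (hI : Set.Icc a b ⊆ Sq) (A B C B₀ c η : ℝ) (hη : 0 < η) (hB₀ : 1 ≤ B₀)
    (hr : ∀ x ∈ Sq, |r x| ≤ B₀) (hs : ∀ x ∈ Sq, |s x| ≤ B₀) (ht : ∀ x ∈ Sq, |t x| ≤ B₀)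
    (hc : 0 < c) (hc1 : c ≤ 1)
    (hexp : ∀ x ∈ Set.Icc a b, ∀ y ∈ Set.Icc a b, c * dist x y ≤ max |p y - p x| |q y - q x|)
    (hC : 1 ≤ |C|) :
    ‖∫ x in Set.Icc a b, e (A * x.1 + B * x.2 + C * φ x)‖ ≤
      (4 * (4 * (5 ^ (η / 2) / (η / 2))) / c + 4 * (6 * B₀ + 8) *
        (4 * (5 ^ (η / 2) / (η / 2))) ^ 2 / c ^ 2) * (1 + |C|) ^ η / |C| := by
  set κ := |C| with hκ
  have hκ0 : 0 < κ := by linarith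
  have cp : ContinuousOn p (Set.Icc a b) := fun x hx =>
    ((H.fst x (hI hx)).continuousWithinAt).mono hI
  have cq : ContinuousOn q (Set.Icc a b) := fun x hx =>
    ((H.snd x (hI hx)).continuousWithinAt).mono hI
  have cg : ContinuousOn (fun x => max |A + C * p x| |B + C * q x|) (Set.Icc a b) := by fun_prop
  obtain ⟨x₀, hx₀, hmin⟩ := isCompact_Icc.exists_isMinOn (Set.nonempty_Icc.2 hab) cg
  have hsqrt : ∀ x ∈ Set.Icc a b, ∀ u, |u| ≤ dist x x₀ →
      1 / √((A + C * p x) ^ 2 + (B + C * q x) ^ 2 + κ) ≤ 2 / (c * κ) * (1 / √(u ^ 2 + 1 / κ)) := by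
    intro x hx u hu
    have h1 := hexp x₀ hx₀ x hx
    have h2 : max |A + C * p x₀| |B + C * q x₀| ≤ max |A + C * p x| |B + C * q x| := hmin hx
    have h3 : κ * max |p x - p x₀| |q x - q x₀| ≤ 2 * max |A + C * p x| |B + C * q x| := by
      rw [mul_max_of_nonneg _ _ hκ0.le, hκ, ← abs_mul, ← abs_mul]
      refine max_le ?_ ?_
      · have e1 : C * (p x - p x₀) = (A + C * p x) - (A + C * p x₀) := by ring
        rw [e1]
        refine (abs_sub _ _).trans ?_
        have := le_max_left |A + C * p x| |B + C * q x|
        have := le_max_left |A + C * p x₀| |B + C * q x₀|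
        linarith
      · have e1 : C * (q x - q x₀) = (B + C * q x) - (B + C * q x₀) := by ring
        rw [e1]
        refine (abs_sub _ _).trans ?_
        have := le_max_right |A + C * p x| |B + C * q x|
        have := le_max_right |A + C * p x₀| |B + C * q x₀|
        linarith
    have h4 : (max |A + C * p x| |B + C * q x|) ^ 2 ≤
        (A + C * p x) ^ 2 + (B + C * q x) ^ 2 := by
      rcases max_choice |A + C * p x| |B + C * q x| with h | h <;> rw [h, sq_abs]
      · linarith [sq_nonneg (B + C * q x)]
      · linarith [sq_nonneg (A + C * p x)]
    have h5 : κ * (c * |u|) ≤ 2 * max |A + C * p x| |B + C * q x| := by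
      rw [dist_comm] at h1
      calc κ * (c * |u|) ≤ κ * (c * dist x x₀) := by gcongr
        _ ≤ κ * max |p x - p x₀| |q x - q x₀| := mul_le_mul_of_nonneg_left h1 hκ0.le
        _ ≤ _ := h3
    have h6 : (κ * (c * |u|)) ^ 2 ≤ 4 * ((A + C * p x) ^ 2 + (B + C * q x) ^ 2) := by
      have := pow_le_pow_left₀ (by positivity) h5 2
      linarith
    have h7 : (c * κ / 2) ^ 2 * (u ^ 2 + 1 / κ) ≤ (A + C * p x) ^ 2 + (B + C * q x) ^ 2 + κ := by
      have e1 : (c * κ / 2) ^ 2 * (u ^ 2 + 1 / κ) =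
          (κ * (c * |u|)) ^ 2 / 4 + c ^ 2 * κ / 4 := by
        rw [mul_pow κ, mul_pow c |u|, sq_abs u]; field_simp; ring
      have : c ^ 2 * κ ≤ 1 * κ := mul_le_mul_of_nonneg_right (pow_le_one₀ hc.le hc1) hκ0.le
      rw [e1]
      linarith
    have h8 : c * κ / 2 * √(u ^ 2 + 1 / κ) ≤ √((A + C * p x) ^ 2 + (B + C * q x) ^ 2 + κ) := by
      rw [← Real.sqrt_sq (by positivity : 0 ≤ c * κ / 2), ← Real.sqrt_mul (sq_nonneg _)]
      exact Real.sqrt_le_sqrt h7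
    calc _ ≤ 1 / (c * κ / 2 * √(u ^ 2 + 1 / κ)) :=
          one_div_le_one_div_of_le (by positivity) h8
      _ = _ := by field_simp
  have hx₀' := mem_Sq.1 (hI hx₀)
  have ha := mem_Sq.1 (hI (Set.left_mem_Icc.2 hab))
  have hb := mem_Sq.1 (hI (Set.right_mem_Icc.2 hab))
  set E : ℝ := 4 * (5 ^ (η / 2) / (η / 2)) with hE
  have hE0 : 0 ≤ E := by positivity
  have hJ : 2 * Real.arsinh (2 * √κ) ≤ E / 2 * (1 + κ) ^ (η / 2) := by
    have := arsinh_le_rpow (η / 2) (by positivity) κ hκ0.le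
    rw [hE]
    linarith
  have cont : ∀ y₀ : ℝ, Continuous fun y : ℝ => 1 / √((y - y₀) ^ 2 + 1 / κ) := fun y₀ =>
    continuous_const.div (by fun_prop) fun x => by positivity
  have main := H.norm_integral_le hab hI A B C κ B₀ hκ0 hr hs ht
    (fun y => 1 / √((y - x₀.1) ^ 2 + 1 / κ)) (fun y => 1 / √((y - x₀.2) ^ 2 + 1 / κ))
    (cont _) (cont _) (fun _ => by positivity) (fun _ => by positivity) (2 / (c * κ))
    (E / 2 * (1 + κ) ^ (η / 2)) (by positivity)
    (fun x hx => hsqrt x hx _ (by rw [Prod.dist_eq, Real.dist_eq]; exact le_max_left _ _))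
    (fun x hx => hsqrt x hx _ (by
      rw [Prod.dist_eq, Real.dist_eq, Real.dist_eq]; exact le_max_right _ _))
    ((integral_one_div_sqrt_le _ _ _ κ hκ0 (by rw [abs_le]; constructor <;> linarith)
      (by rw [abs_le]; constructor <;> linarith)).trans hJ)
    ((integral_one_div_sqrt_le _ _ _ κ hκ0 (by rw [abs_le]; constructor <;> linarith)
      (by rw [abs_le]; constructor <;> linarith)).trans hJ)
  refine main.trans ?_
  have hpow : (1 + κ) ^ (η / 2) ≤ (1 + κ) ^ η :=
    Real.rpow_le_rpow_of_exponent_le (by linarith) (by linarith)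
  have hpow2 : ((1 + κ) ^ (η / 2)) ^ 2 = (1 + κ) ^ η := by
    rw [← Real.rpow_natCast, ← Real.rpow_mul (by positivity)]
    congr 1; push_cast; ring
  have hpi := Real.pi_lt_four
  have e1 : 2 / (c * κ) * (E / 2 * (1 + κ) ^ (η / 2)) = E / c * (1 + κ) ^ (η / 2) / κ := by
    field_simp
  rw [e1]
  have t1 : 4 * (E / c * (1 + κ) ^ (η / 2) / κ) ≤ 4 * E / c * (1 + κ) ^ η / κ := by
    have : 4 * (E / c * (1 + κ) ^ (η / 2) / κ) = 4 * E / c * (1 + κ) ^ (η / 2) / κ := by ring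
    rw [this]; gcongr
  have t2 : (6 * B₀ * κ + 2 * Real.pi * κ) * (E / c * (1 + κ) ^ (η / 2) / κ) ^ 2 ≤
      4 * (6 * B₀ + 8) * E ^ 2 / c ^ 2 * (1 + κ) ^ η / κ := by
    have : (6 * B₀ * κ + 2 * Real.pi * κ) * (E / c * (1 + κ) ^ (η / 2) / κ) ^ 2 =
        (6 * B₀ + 2 * Real.pi) * E ^ 2 / c ^ 2 * (1 + κ) ^ η / κ := by
      rw [← hpow2]; field_simp
    rw [this]
    have : 6 * B₀ + 2 * Real.pi ≤ 4 * (6 * B₀ + 8) := by linarith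
    gcongr
  refine (add_le_add t1 t2).trans (le_of_eq ?_)
  ring

/-- Decay of the oscillatory integral over small rectangles. -/
lemma HasHessianOnSq.exists_norm_integral_le (H : HasHessianOnSq φ p q r s t) {ε : ℝ} (hε : 0 < ε)
    (hdet : ∀ x ∈ Sq, ε ≤ |r x * t x - s x ^ 2|) :
    ∃ δ > 0, ∀ η > (0 : ℝ), ∃ K₀ > 0, ∀ a b : ℝ × ℝ, a ≤ b → Set.Icc a b ⊆ Sq → dist a b < δ →
      ∀ A B C : ℝ, ‖∫ x in Set.Icc a b, e (A * x.1 + B * x.2 + C * φ x)‖ ≤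
        K₀ * (1 + |C|) ^ η / (1 + max |A| (max |B| |C|)) := by
  have bdd : ∀ f : ℝ × ℝ → ℝ, ContinuousOn f Sq → ∃ b, ∀ x ∈ Sq, |f x| ≤ b := fun f hf =>
    isCompact_Sq.exists_bound_of_continuousOn hf
  obtain ⟨b1, h1⟩ := bdd p fun x hx => (H.fst x hx).continuousWithinAt
  obtain ⟨b2, h2⟩ := bdd q fun x hx => (H.snd x hx).continuousWithinAt
  obtain ⟨b3, h3⟩ := bdd r H.cont_r
  obtain ⟨b4, h4⟩ := bdd s H.cont_s
  obtain ⟨b5, h5⟩ := bdd t H.cont_t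
  obtain ⟨B₀, hB1, hB2, hB3, hB4, hB5, hB6⟩ : ∃ B₀ : ℝ, 1 ≤ B₀ ∧ b1 ≤ B₀ ∧ b2 ≤ B₀ ∧ b3 ≤ B₀ ∧
      b4 ≤ B₀ ∧ b5 ≤ B₀ :=
    ⟨1 + |b1| + |b2| + |b3| + |b4| + |b5|, by
      have := abs_nonneg b1
      have := abs_nonneg b2
      have := abs_nonneg b3
      have := abs_nonneg b4
      have := abs_nonneg b5
      have := le_abs_self b1
      have := le_abs_self b2
      have := le_abs_self b3
      have := le_abs_self b4
      have := le_abs_self b5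
      refine ⟨?_, ?_, ?_, ?_, ?_, ?_⟩ <;> linarith⟩
  have hp := fun x hx => (h1 x hx).trans hB2
  have hq := fun x hx => (h2 x hx).trans hB3
  have hr := fun x hx => (h3 x hx).trans hB4
  have hs := fun x hx => (h4 x hx).trans hB5
  have ht := fun x hx => (h5 x hx).trans hB6
  obtain ⟨δ, hδ, c, hc, hexp⟩ := H.exists_le_gradient_sub hε hr hs ht hdet
  refine ⟨δ, hδ, fun η hη => ?_⟩
  set c' := min c 1 with hc'
  have hc0 : 0 < c' := lt_min hc one_pos
  set G : ℝ := 4 * (4 * (5 ^ (η / 2) / (η / 2))) / c' + 4 * (6 * B₀ + 8) *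
        (4 * (5 ^ (η / 2) / (η / 2))) ^ 2 / c' ^ 2 with hG
  have hG0 : 0 ≤ G := by positivity
  refine ⟨400 + 5 * B₀ * G + 5 * B₀ * (40 + 24 * B₀), by positivity,
    fun a b hab hI hlt A B C => ?_⟩
  have hpow : 1 ≤ (1 + |C|) ^ η := Real.one_le_rpow (by linarith [abs_nonneg C]) hη.le
  have hC0 := abs_nonneg C
  set X := max |A| (max |B| |C|) with hX
  have hX0 : 0 ≤ X := (abs_nonneg A).trans (le_max_left _ _)
  have hBG : 0 ≤ 5 * B₀ * G := by positivity
  have hBB : 0 ≤ 5 * B₀ * (40 + 24 * B₀) := by positivity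
  have hXm : X = max (max |A| |B|) |C| := by rw [hX, max_assoc]
  by_cases hlin : 1 ≤ max |A| |B| ∧ 4 * B₀ * |C| ≤ max |A| |B|
  · have hle := H.norm_integral_le_of_linear hab hI A B C B₀ _ hp hq hr hs ht rfl hlin.1 hlin.2
    have hCm : |C| ≤ max |A| |B| := by nlinarith [hlin.2]
    rw [max_eq_left hCm] at hXm
    rw [← hXm] at hle hlin
    refine hle.trans ?_
    rw [div_le_div_iff₀ (by linarith) (by linarith)]
    have : 400 * 1 ≤ (400 + 5 * B₀ * G + 5 * B₀ * (40 + 24 * B₀)) * (1 + |C|) ^ η :=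
      mul_le_mul (by linarith) hpow zero_le_one (by linarith)
    nlinarith
  have hsmall : max |A| |B| ≤ max 1 (4 * B₀ * |C|) := by
    by_contra hcon
    push Not at hcon
    exact hlin ⟨(le_max_left _ _).trans hcon.le, (le_max_right _ _).trans hcon.le⟩
  by_cases hC : 1 ≤ |C|
  · have hle := H.norm_integral_le_of_curved hab hI A B C B₀ c' η hη hB1 hr hs ht hc0
      (min_le_right _ _) (fun x hx y hy => by
        refine le_trans ?_ (hexp x (hI hx) y (hI hy) ?_)
        · exact mul_le_mul_of_nonneg_right (min_le_left _ _) dist_nonneg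
        · refine lt_of_le_of_lt ?_ hlt
          rw [Prod.dist_eq, Prod.dist_eq]
          exact max_le_max (Real.dist_le_of_mem_Icc ⟨hx.1.1, hx.2.1⟩ ⟨hy.1.1, hy.2.1⟩ |>.trans
              (by rw [dist_comm, Real.dist_eq]; exact le_abs_self _))
            (Real.dist_le_of_mem_Icc ⟨hx.1.2, hx.2.2⟩ ⟨hy.1.2, hy.2.2⟩ |>.trans
              (by rw [dist_comm, Real.dist_eq]; exact le_abs_self _))) hC
    refine hle.trans ?_
    rw [← hG, div_le_div_iff₀ (by linarith) (by linarith)]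
    have hX4 : 1 + X ≤ 5 * B₀ * |C| := by
      have h6 : 1 ≤ B₀ * |C| := by nlinarith
      have h7 : max |A| |B| ≤ 4 * (B₀ * |C|) := hsmall.trans (max_le (by linarith) (by linarith))
      have : X ≤ 4 * (B₀ * |C|) := by rw [hXm]; exact max_le h7 (by nlinarith)
      linarith
    calc G * (1 + |C|) ^ η * (1 + X) ≤ G * (1 + |C|) ^ η * (5 * B₀ * |C|) := by gcongr
      _ = 5 * B₀ * G * (1 + |C|) ^ η * |C| := by ring
      _ ≤ _ := by gcongr; linarith
  · push Not at hC
    have hle := H.norm_integral_le_trivial hab hI A B C B₀ hr hs ht 1 zero_le_one (fun x _ => by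
      rw [div_le_one (Real.sqrt_pos.2 (by positivity))]
      exact Real.one_le_sqrt.2 (by nlinarith [sq_nonneg (A + C * p x), sq_nonneg (B + C * q x)]))
    refine hle.trans ?_
    rw [le_div_iff₀ (by linarith)]
    have hX4 : 1 + X ≤ 5 * B₀ := by
      have h7 : max |A| |B| ≤ 4 * B₀ := hsmall.trans (max_le (by linarith) (by nlinarith))
      have : X ≤ 4 * B₀ := by rw [hXm]; exact max_le h7 (by linarith)
      linarith
    have hpi := Real.pi_lt_four
    have h8 : 8 * 1 + 4 * (6 * B₀ * |C| + 2 * Real.pi) * 1 ^ 2 ≤ 40 + 24 * B₀ := by nlinarith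
    calc _ ≤ (40 + 24 * B₀) * (5 * B₀) :=
          mul_le_mul h8 hX4 (by linarith) (by linarith)
      _ = 5 * B₀ * (40 + 24 * B₀) * 1 := by ring
      _ ≤ _ := mul_le_mul (by linarith) hpow zero_le_one (by linarith)

end

lemma uniqueDiffOn_Sq : UniqueDiffOn ℝ Sq :=
  (uniqueDiffOn_Icc (by norm_num)).prod (uniqueDiffOn_Icc (by norm_num))

lemma Sq_subset_closure_interior : Sq ⊆ closure (interior Sq) := by
  rw [Sq, interior_prod_eq, closure_prod_eq, interior_Icc, closure_Ioo (by norm_num)]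

lemma eq_lin (L : ℝ × ℝ →L[ℝ] ℝ) : L = lin (L (1, 0)) (L (0, 1)) := by
  ext <;> simp

/-- A twice continuously differentiable function on the square has a continuous Hessian there. -/
lemma ContDiffOn.hasHessianOnSq {φ : ℝ × ℝ → ℝ} (hφ : ContDiffOn ℝ 2 φ Sq) :
    HasHessianOnSq φ (fun x => fderivWithin ℝ φ Sq x (1, 0))
      (fun x => fderivWithin ℝ φ Sq x (0, 1))
      (fun x => iteratedFDerivWithin ℝ 2 φ Sq x ![(1, 0), (1, 0)])
      (fun x => iteratedFDerivWithin ℝ 2 φ Sq x ![(1, 0), (0, 1)])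
      (fun x => iteratedFDerivWithin ℝ 2 φ Sq x ![(0, 1), (0, 1)]) := by
  have h1 : ContDiffOn ℝ 1 (fderivWithin ℝ φ Sq) Sq :=
    hφ.fderivWithin uniqueDiffOn_Sq (by norm_num)
  have h2 : ∀ x ∈ Sq, HasFDerivWithinAt (fderivWithin ℝ φ Sq)
      (fderivWithin ℝ (fderivWithin ℝ φ Sq) Sq x) Sq x := fun x hx =>
    ((h1.differentiableOn one_ne_zero) x hx).hasFDerivWithinAt
  have h3 : ∀ v, ∀ x ∈ Sq, HasFDerivWithinAt (fun x => fderivWithin ℝ φ Sq x v)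
      ((fderivWithin ℝ (fderivWithin ℝ φ Sq) Sq x).flip v) Sq x := fun v x hx => by
    have := ((ContinuousLinearMap.apply ℝ ℝ v).hasFDerivAt).comp_hasFDerivWithinAt x (h2 x hx)
    exact this
  have hsymm : ∀ x ∈ Sq, ∀ v w, fderivWithin ℝ (fderivWithin ℝ φ Sq) Sq x v w =
      fderivWithin ℝ (fderivWithin ℝ φ Sq) Sq x w v := fun x hx v w =>
    (hφ x hx).isSymmSndFDerivWithinAt (by simp) uniqueDiffOn_Sq
      (Sq_subset_closure_interior hx) hx v w
  have hcont : ∀ v, ContinuousOn (fun x => iteratedFDerivWithin ℝ 2 φ Sq x v) Sq := fun v =>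
    (ContinuousMultilinearMap.apply ℝ _ ℝ v).continuous.comp_continuousOn
      (hφ.continuousOn_iteratedFDerivWithin (by norm_num) uniqueDiffOn_Sq)
  refine ⟨fun x hx => ?_, fun x hx => ?_, fun x hx => ?_, hcont _, hcont _, hcont _⟩
  · rw [← eq_lin]
    exact ((hφ.differentiableOn two_ne_zero) x hx).hasFDerivWithinAt
  · refine (h3 (1, 0) x hx).congr_fderiv ?_
    rw [eq_lin ((fderivWithin ℝ (fderivWithin ℝ φ Sq) Sq x).flip (1, 0))]
    simp only [iteratedFDerivWithin_two_apply' _ uniqueDiffOn_Sq hx, ContinuousLinearMap.flip_apply]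
    rw [hsymm x hx (0, 1)]
  · refine (h3 (0, 1) x hx).congr_fderiv ?_
    rw [eq_lin ((fderivWithin ℝ (fderivWithin ℝ φ Sq) Sq x).flip (0, 1))]
    simp only [iteratedFDerivWithin_two_apply' _ uniqueDiffOn_Sq hx, ContinuousLinearMap.flip_apply]

lemma e_add (x y : ℝ) : e (x + y) = e x * e y := by
  rw [e, e, e, ← Complex.exp_add]
  congr 1
  push_cast
  ring

lemma conj_e (x : ℝ) : (starRingEnd ℂ) (e x) = e (-x) := by
  rw [e, e, ← Complex.exp_conj]
  simp [Complex.conj_ofNat]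

/-- Schur's test for a Gram matrix. -/
lemma integral_norm_sum_sq_le {X ι : Type*} [MeasurableSpace X] {μ : Measure X} (s : Finset ι)
    (c : ι → ℂ) (E : ι → X → ℂ)
    (hE : ∀ i j, Integrable (fun x => E i x * (starRingEnd ℂ) (E j x)) μ) (k : ι → ι → ℝ)
    (hk : ∀ i ∈ s, ∀ j ∈ s, ‖∫ x, E i x * (starRingEnd ℂ) (E j x) ∂μ‖ ≤ k i j)
    (hsymm : ∀ i j, k i j = k j i) (Λ : ℝ) (hΛ : ∀ i ∈ s, ∑ j ∈ s, k i j ≤ Λ) :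
    ∫ x, ‖∑ i ∈ s, c i * E i x‖ ^ 2 ∂μ ≤ Λ * ∑ i ∈ s, ‖c i‖ ^ 2 := by
  have h1 : ∀ x, ((‖∑ i ∈ s, c i * E i x‖ ^ 2 : ℝ) : ℂ) =
      ∑ i ∈ s, ∑ j ∈ s, (c i * (starRingEnd ℂ) (c j)) * (E i x * (starRingEnd ℂ) (E j x)) := by
    intro x
    rw [Complex.ofReal_pow, ← Complex.mul_conj', map_sum, Finset.sum_mul_sum]
    refine Finset.sum_congr rfl fun i _ => Finset.sum_congr rfl fun j _ => ?_
    rw [map_mul]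
    ring
  have h2 : ((∫ x, ‖∑ i ∈ s, c i * E i x‖ ^ 2 ∂μ : ℝ) : ℂ) =
      ∑ i ∈ s, ∑ j ∈ s, (c i * (starRingEnd ℂ) (c j)) *
        ∫ x, E i x * (starRingEnd ℂ) (E j x) ∂μ := by
    rw [← integral_complex_ofReal]
    simp_rw [h1]
    rw [integral_finsetSum _ fun i _ => integrable_finsetSum _ fun j _ => (hE i j).const_mul _]
    refine Finset.sum_congr rfl fun i _ => ?_
    rw [integral_finsetSum _ fun j _ => (hE i j).const_mul _]
    exact Finset.sum_congr rfl fun j _ => integral_const_mul _ _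
  have h3 : ∫ x, ‖∑ i ∈ s, c i * E i x‖ ^ 2 ∂μ ≤
      ∑ i ∈ s, ∑ j ∈ s, (‖c i‖ ^ 2 / 2 * k i j + ‖c j‖ ^ 2 / 2 * k j i) := by
    refine (le_abs_self _).trans ?_
    rw [← Real.norm_eq_abs, ← Complex.norm_real, h2]
    refine norm_sum_le_of_le _ fun i hi => norm_sum_le_of_le _ fun j hj => ?_
    rw [norm_mul, norm_mul, RCLike.norm_conj, hsymm j i, ← add_mul]
    refine mul_le_mul ?_ (hk i hi j hj) (norm_nonneg _) (by positivity)
    nlinarith [sq_nonneg (‖c i‖ - ‖c j‖)]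
  have h4 : ∑ i ∈ s, ∑ j ∈ s, ‖c i‖ ^ 2 / 2 * k i j ≤ Λ / 2 * ∑ i ∈ s, ‖c i‖ ^ 2 := by
    rw [Finset.mul_sum]
    refine Finset.sum_le_sum fun i hi => ?_
    rw [← Finset.mul_sum]
    have := mul_le_mul_of_nonneg_left (hΛ i hi) (by positivity : 0 ≤ ‖c i‖ ^ 2 / 2)
    linarith
  have h5 : ∑ i ∈ s, ∑ j ∈ s, ‖c j‖ ^ 2 / 2 * k j i ≤ Λ / 2 * ∑ i ∈ s, ‖c i‖ ^ 2 := by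
    rw [Finset.sum_comm]
    exact h4
  simp only [Finset.sum_add_distrib] at h3
  linarith

/-- The exponential sum over the block `[K, 2K)`, reflected when `σ = -1`. -/
noncomputable def blockSum (φ : ℝ × ℝ → ℝ) (a : ℤ → ℂ) (σ K : ℤ) (x : ℝ × ℝ) : ℂ :=
  ∑ n ∈ Finset.Ico K (2 * K),
    a n * e ((σ * n : ℤ) * x.1 + (n : ℝ) ^ 2 * x.2 + (σ * n ^ 3 : ℤ) * φ x)

lemma blockSum_cube (φ : ℝ × ℝ → ℝ) (a : ℤ → ℂ) (σ K : ℤ) (x : ℝ × ℝ) :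
    blockSum φ a σ K x ^ 3 = ∑ T ∈ triples K, (a T.1 * a T.2.1 * a T.2.2) *
      e ((σ * pw 1 T : ℤ) * x.1 + (pw 2 T : ℝ) * x.2 + (σ * pw 3 T : ℤ) * φ x) := by
  rw [triples, Finset.sum_product, pow_succ', pow_two, blockSum, Finset.sum_mul_sum,
    Finset.sum_mul_sum]
  refine Finset.sum_congr rfl fun n _ => ?_
  rw [Finset.sum_product]
  refine Finset.sum_congr rfl fun m _ => ?_
  rw [Finset.mul_sum]
  refine Finset.sum_congr rfl fun l _ => ?_
  have : e ((σ * pw 1 (n, m, l) : ℤ) * x.1 + (pw 2 (n, m, l) : ℝ) * x.2 +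
      (σ * pw 3 (n, m, l) : ℤ) * φ x) =
      e ((σ * n : ℤ) * x.1 + (n : ℝ) ^ 2 * x.2 + (σ * n ^ 3 : ℤ) * φ x) *
      (e ((σ * m : ℤ) * x.1 + (m : ℝ) ^ 2 * x.2 + (σ * m ^ 3 : ℤ) * φ x) *
      e ((σ * l : ℤ) * x.1 + (l : ℝ) ^ 2 * x.2 + (σ * l ^ 3 : ℤ) * φ x)) := by
    rw [← e_add, ← e_add]
    congr 1
    simp only [pw]
    push_cast
    ring
  rw [this]
  ring

lemma sum_triples_norm_sq (a : ℤ → ℂ) (K : ℤ) :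
    ∑ T ∈ triples K, ‖a T.1 * a T.2.1 * a T.2.2‖ ^ 2 =
      (∑ n ∈ Finset.Ico K (2 * K), ‖a n‖ ^ 2) ^ 3 := by
  rw [triples, Finset.sum_product, pow_succ', pow_two, Finset.sum_mul_sum, Finset.sum_mul_sum]
  refine Finset.sum_congr rfl fun n _ => ?_
  rw [Finset.sum_product]
  refine Finset.sum_congr rfl fun m _ => ?_
  rw [Finset.mul_sum]
  refine Finset.sum_congr rfl fun l _ => ?_
  rw [norm_mul, norm_mul]
  ring

lemma gap_comm (T T' : ℤ × ℤ × ℤ) : gap T T' = gap T' T := by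
  simp only [gap]
  rw [← Int.natAbs_neg (pw 1 T' - pw 1 T), ← Int.natAbs_neg (pw 2 T' - pw 2 T),
    ← Int.natAbs_neg (pw 3 T' - pw 3 T), neg_sub, neg_sub, neg_sub]

lemma cast_gap (T T' : ℤ × ℤ × ℤ) {σ : ℤ} (hσ : |σ| = 1) :
    (gap T T' : ℝ) = max |((σ * (pw 1 T' - pw 1 T) : ℤ) : ℝ)|
      (max |((pw 2 T' - pw 2 T : ℤ) : ℝ)| |((σ * (pw 3 T' - pw 3 T) : ℤ) : ℝ)|) := by
  simp only [gap, Nat.cast_max, Nat.cast_natAbs, ← Int.cast_abs, abs_mul, hσ, one_mul]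

lemma HasHessianOnSq.continuousOn {φ p q r s t : ℝ × ℝ → ℝ} (H : HasHessianOnSq φ p q r s t) :
    ContinuousOn φ Sq := fun x hx => (H.grad x hx).continuousWithinAt

lemma continuousOn_blockSum {φ : ℝ × ℝ → ℝ} (hφ : ContinuousOn φ Sq) (a : ℤ → ℂ) (σ K : ℤ) :
    ContinuousOn (blockSum φ a σ K) Sq := by
  have := continuous_e
  unfold blockSum
  fun_prop

/-- The sixth moment of a block sum over a small rectangle. -/
lemma HasHessianOnSq.exists_integral_blockSum_le {φ p q r s t : ℝ × ℝ → ℝ}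
    (H : HasHessianOnSq φ p q r s t) {ε₀ : ℝ} (hε₀ : 0 < ε₀)
    (hdet : ∀ x ∈ Sq, ε₀ ≤ |r x * t x - s x ^ 2|) :
    ∃ δ > 0, ∀ a b : ℝ × ℝ, a ≤ b → Set.Icc a b ⊆ Sq → dist a b < δ → ∀ ε > (0 : ℝ), ∃ M > 0,
      ∀ K σ : ℤ, 1 ≤ K → |σ| = 1 → ∀ c : ℤ → ℂ,
      ∫ x in Set.Icc a b, ‖blockSum φ c σ K x‖ ^ 6 ≤
        M * (K : ℝ) ^ ε * (∑ n ∈ Finset.Ico K (2 * K), ‖c n‖ ^ 2) ^ 3 := by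
  obtain ⟨δ, hδ, h⟩ := H.exists_norm_integral_le hε₀ hdet
  refine ⟨δ, hδ, fun a b hab hI hlt ε hε => ?_⟩
  obtain ⟨K₀, hK₀, hosc⟩ := h (ε / 6) (by positivity)
  obtain ⟨M, hM, hsum⟩ := exists_sum_one_div_gap_le (ε / 2) (by positivity)
  refine ⟨K₀ * 25 ^ (ε / 6) * M, by positivity, fun K σ hK hσ c => ?_⟩
  have hK' : (1 : ℝ) ≤ K := by exact_mod_cast hK
  have hK0 : (0 : ℝ) < K := by linarith
  set E : ℤ × ℤ × ℤ → ℝ × ℝ → ℂ := fun T x =>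
    e ((σ * pw 1 T : ℤ) * x.1 + (pw 2 T : ℝ) * x.2 + (σ * pw 3 T : ℤ) * φ x) with hE
  set κ : ℝ := K₀ * (25 ^ (ε / 6) * (K : ℝ) ^ (ε / 2)) with hκ
  have hEE : ∀ T T' x, E T x * (starRingEnd ℂ) (E T' x) =
      e (((σ * (pw 1 T - pw 1 T') : ℤ) : ℝ) * x.1 + ((pw 2 T - pw 2 T' : ℤ) : ℝ) * x.2 +
        ((σ * (pw 3 T - pw 3 T') : ℤ) : ℝ) * φ x) := by
    intro T T' x
    simp only [hE]
    rw [conj_e, ← e_add]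
    congr 1
    push_cast
    ring
  have hφ : ContinuousOn φ (Set.Icc a b) := H.continuousOn.mono hI
  have key := integral_norm_sum_sq_le (μ := volume.restrict (Set.Icc a b)) (triples K)
    (fun T => c T.1 * c T.2.1 * c T.2.2) E (fun T T' => by
      simp_rw [hEE]
      refine ContinuousOn.integrableOn_compact isCompact_Icc ?_
      have := continuous_e
      fun_prop) (fun T T' => κ * (1 / ((gap T T' : ℝ) + 1))) (fun T hT T' hT' => by
      simp_rw [hEE]
      refine (hosc a b hab hI hlt _ _ _).trans ?_
      rw [← cast_gap T' T hσ, gap_comm, add_comm 1 (gap T T' : ℝ), mul_one_div]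
      refine div_le_div_of_nonneg_right (mul_le_mul_of_nonneg_left ?_ hK₀.le) (by positivity)
      have h1 : |((σ * (pw 3 T - pw 3 T') : ℤ) : ℝ)| ≤ gap T' T := by
        rw [cast_gap T' T hσ]
        exact (le_max_right _ _).trans (le_max_right _ _)
      have h2 : (gap T' T : ℝ) ≤ 24 * (K : ℝ) ^ 3 := by exact_mod_cast gap_le K T' T hK hT' hT
      have h3 : (1 : ℝ) ≤ (K : ℝ) ^ 3 := one_le_pow₀ hK'
      calc (1 + |((σ * (pw 3 T - pw 3 T') : ℤ) : ℝ)|) ^ (ε / 6)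
          ≤ (25 * (K : ℝ) ^ 3) ^ (ε / 6) :=
            Real.rpow_le_rpow (by positivity) (by linarith) (by positivity)
        _ = 25 ^ (ε / 6) * (K : ℝ) ^ (ε / 2) := by
            rw [Real.mul_rpow (by norm_num) (by positivity), ← Real.rpow_natCast,
              ← Real.rpow_mul hK0.le]
            congr 2
            push_cast
            ring) (fun T T' => by rw [gap_comm]) (κ * (M * (K : ℝ) ^ (ε / 2))) (fun T hT => by
      rw [← Finset.mul_sum]
      exact mul_le_mul_of_nonneg_left (hsum K T hK hT) (by positivity))
  have e1 : ∀ x, ‖∑ T ∈ triples K, c T.1 * c T.2.1 * c T.2.2 * E T x‖ ^ 2 =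
      ‖blockSum φ c σ K x‖ ^ 6 := fun x => by
    rw [← blockSum_cube, norm_pow, ← pow_mul]
  simp_rw [e1, sum_triples_norm_sq] at key
  refine key.trans (le_of_eq ?_)
  congr 1
  rw [hκ, show K₀ * (25 ^ (ε / 6) * (K : ℝ) ^ (ε / 2)) * (M * (K : ℝ) ^ (ε / 2)) =
    K₀ * 25 ^ (ε / 6) * M * ((K : ℝ) ^ (ε / 2) * (K : ℝ) ^ (ε / 2)) by ring,
    ← Real.rpow_add hK0, add_halves]

lemma HasHessianOnSq.exists_lintegral_blockSum_le {φ p q r s t : ℝ × ℝ → ℝ}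
    (H : HasHessianOnSq φ p q r s t) {ε₀ : ℝ} (hε₀ : 0 < ε₀)
    (hdet : ∀ x ∈ Sq, ε₀ ≤ |r x * t x - s x ^ 2|) (ε : ℝ) (hε : 0 < ε) : ∃ M > 0,
      ∀ K σ : ℤ, 1 ≤ K → |σ| = 1 → ∀ c : ℤ → ℂ,
      ∫⁻ x in Sq, ‖blockSum φ c σ K x‖ₑ ^ 6 ≤ ENNReal.ofReal
        (M * (K : ℝ) ^ ε * (∑ n ∈ Finset.Ico K (2 * K), ‖c n‖ ^ 2) ^ 3) := by
  obtain ⟨δ, hδ, h⟩ := H.exists_integral_blockSum_le hε₀ hdet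
  refine isCompact_Sq.induction_on (p := fun S => ∃ M > 0, ∀ K σ : ℤ, 1 ≤ K → |σ| = 1 →
    ∀ c : ℤ → ℂ, ∫⁻ x in S, ‖blockSum φ c σ K x‖ₑ ^ 6 ≤ ENNReal.ofReal
        (M * (K : ℝ) ^ ε * (∑ n ∈ Finset.Ico K (2 * K), ‖c n‖ ^ 2) ^ 3))
    ⟨1, one_pos, fun K σ _ _ c => by simp⟩ ?_ ?_ ?_
  · rintro S S' hS ⟨M, hM, h'⟩
    exact ⟨M, hM, fun K σ hK hσ c => (lintegral_mono_set hS).trans (h' K σ hK hσ c)⟩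
  · rintro S S' ⟨M, hM, h1⟩ ⟨M', hM', h2⟩
    refine ⟨M + M', by positivity, fun K σ hK hσ c => (lintegral_union_le _ _ _).trans ?_⟩
    have hK0 : (0 : ℝ) ≤ K := by exact_mod_cast zero_le_one.trans hK
    rw [add_mul, add_mul, ENNReal.ofReal_add (by positivity) (by positivity)]
    exact add_le_add (h1 K σ hK hσ c) (h2 K σ hK hσ c)
  · intro x hx
    set a : ℝ × ℝ := (-1, -1) ⊔ (x.1 - δ / 3, x.2 - δ / 3) with ha
    set b : ℝ × ℝ := (1, 1) ⊓ (x.1 + δ / 3, x.2 + δ / 3) with hb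
    have hx' := mem_Sq.1 hx
    have hxI : x ∈ Set.Icc a b := by
      refine ⟨⟨?_, ?_⟩, ⟨?_, ?_⟩⟩ <;> simp [ha, hb] <;> constructor <;> linarith
    have hI : Set.Icc a b ⊆ Sq := by
      intro y hy
      have h1 := hy.1.1
      have h2 := hy.1.2
      have h3 := hy.2.1
      have h4 := hy.2.2
      simp only [ha, hb, Prod.fst_sup, Prod.snd_sup, Prod.fst_inf, Prod.snd_inf, sup_le_iff,
        le_inf_iff] at h1 h2 h3 h4
      exact ⟨⟨h1.1, h3.1⟩, ⟨h2.1, h4.1⟩⟩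
    have hab : a ≤ b := hxI.1.trans hxI.2
    have hdist : dist a b < δ := by
      have h1 := hab.1
      have h2 := hab.2
      have h3 : x.1 - δ / 3 ≤ a.1 := le_sup_right
      have h4 : x.2 - δ / 3 ≤ a.2 := le_sup_right
      have h5 : b.1 ≤ x.1 + δ / 3 := inf_le_right
      have h6 : b.2 ≤ x.2 + δ / 3 := inf_le_right
      rw [Prod.dist_eq, Real.dist_eq, Real.dist_eq]
      refine max_lt ?_ ?_ <;> rw [abs_lt] <;> constructor <;> linarith
    obtain ⟨M, hM, hle⟩ := h a b hab hI hdist ε hε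
    refine ⟨Set.Icc a b, ?_, M, hM, fun K σ hK hσ c => ?_⟩
    · rw [mem_nhdsWithin_iff_exists_mem_nhds_inter]
      refine ⟨Set.Icc (x.1 - δ / 3, x.2 - δ / 3) (x.1 + δ / 3, x.2 + δ / 3), ?_, ?_⟩
      · rw [Set.Icc_prod_eq]
        exact prod_mem_nhds (Icc_mem_nhds (by linarith) (by linarith))
          (Icc_mem_nhds (by linarith) (by linarith))
      · rintro y ⟨hy, hy'⟩
        have hy'' := mem_Sq.1 hy'
        exact ⟨sup_le ⟨hy''.1.1, hy''.2.1⟩ hy.1, le_inf ⟨hy''.1.2, hy''.2.2⟩ hy.2⟩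
    · refine le_trans (le_of_eq ?_) (ENNReal.ofReal_le_ofReal (hle K σ hK hσ c))
      rw [ofReal_integral_eq_lintegral_ofReal]
      · refine lintegral_congr fun x => ?_
        rw [ENNReal.ofReal_pow (norm_nonneg _), ofReal_norm]
      · exact (((continuousOn_blockSum H.continuousOn c σ K).mono hI).norm.pow
          6).integrableOn_compact isCompact_Icc
      · exact Filter.Eventually.of_forall fun x => by positivity

lemma HasHessianOnSq.exists_eLpNorm_blockSum_le {φ p q r s t : ℝ × ℝ → ℝ}
    (H : HasHessianOnSq φ p q r s t) {ε₀ : ℝ} (hε₀ : 0 < ε₀)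
    (hdet : ∀ x ∈ Sq, ε₀ ≤ |r x * t x - s x ^ 2|) (ε : ℝ) (hε : 0 < ε) : ∃ M > 0,
      ∀ K σ : ℤ, 1 ≤ K → |σ| = 1 → ∀ c : ℤ → ℂ,
      eLpNorm (blockSum φ c σ K) 6 (volume.restrict Sq) ≤ ENNReal.ofReal
        (M * (K : ℝ) ^ ε * √(∑ n ∈ Finset.Ico K (2 * K), ‖c n‖ ^ 2)) := by
  obtain ⟨M, hM, h⟩ := H.exists_lintegral_blockSum_le hε₀ hdet (6 * ε) (by positivity)
  refine ⟨M ^ (1 / 6 : ℝ), by positivity, fun K σ hK hσ c => ?_⟩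
  have hK0 : (0 : ℝ) ≤ K := by exact_mod_cast zero_le_one.trans hK
  set S := ∑ n ∈ Finset.Ico K (2 * K), ‖c n‖ ^ 2 with hS
  have hS0 : 0 ≤ S := Finset.sum_nonneg fun n _ => by positivity
  refine (ENNReal.pow_le_pow_left_iff (n := 6) (by norm_num)).1 ?_
  have h1 : eLpNorm (blockSum φ c σ K) 6 (volume.restrict Sq) ^ 6 =
      ∫⁻ x in Sq, ‖blockSum φ c σ K x‖ₑ ^ 6 := by
    have := eLpNorm_nnreal_pow_eq_lintegral (μ := volume.restrict Sq) (f := blockSum φ c σ K)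
      (p := 6) (by norm_num)
    norm_num at this
    exact_mod_cast this
  rw [h1, ← ENNReal.ofReal_pow (by positivity)]
  refine (h K σ hK hσ c).trans (le_of_eq ?_)
  congr 1
  have e1 : (M ^ (1 / 6 : ℝ)) ^ 6 = M := by
    rw [← Real.rpow_natCast, ← Real.rpow_mul hM.le]; norm_num
  have e2 : ((K : ℝ) ^ ε) ^ 6 = (K : ℝ) ^ (6 * ε) := by
    rw [← Real.rpow_natCast, ← Real.rpow_mul hK0]; congr 1; push_cast; ring
  have e3 : √S ^ 6 = S ^ 3 := by
    rw [show 6 = 2 * 3 by norm_num, pow_mul, Real.sq_sqrt hS0]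
  rw [mul_pow, mul_pow, e1, e2, e3]

lemma sum_range_sum_Ico_two_pow (g : ℤ → ℂ) (m : ℕ) :
    ∑ k ∈ Finset.range m, ∑ n ∈ Finset.Ico ((2 : ℤ) ^ k) (2 * 2 ^ k), g n =
      ∑ n ∈ Finset.Ico 1 ((2 : ℤ) ^ m), g n := by
  induction m with
  | zero => simp
  | succ m ih =>
    have h1 : (1 : ℤ) ≤ 2 ^ m := one_le_pow₀ (by norm_num)
    rw [Finset.sum_range_succ, ih, pow_succ', ← Finset.sum_union
      (Finset.Ico_disjoint_Ico_consecutive _ _ _), Finset.Ico_union_Ico_eq_Ico h1 (by omega)]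

lemma exists_log_add_one_le (ε : ℝ) (hε : 0 < ε) :
    ∃ M > 0, ∀ N : ℕ, 0 < N → (Nat.log 2 N : ℝ) + 1 ≤ M * (N : ℝ) ^ ε := by
  set θ : ℝ := 2 ^ ε - 1 with hθ
  have hθ0 : 0 < θ := by
    have := Real.one_lt_rpow (one_lt_two : (1 : ℝ) < 2) hε
    linarith
  refine ⟨1 / θ + 1, by positivity, fun N hN => ?_⟩
  have h1 := one_add_mul_le_pow (by linarith : -2 ≤ θ) (Nat.log 2 N)
  have h2 : (1 + θ) ^ Nat.log 2 N ≤ (N : ℝ) ^ ε := by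
    rw [hθ, add_sub_cancel, ← Real.rpow_natCast, ← Real.rpow_mul zero_le_two, mul_comm,
      Real.rpow_mul zero_le_two, Real.rpow_natCast]
    refine Real.rpow_le_rpow (by positivity) ?_ hε.le
    exact_mod_cast Nat.pow_log_le_self 2 hN.ne'
  have h3 : (1 : ℝ) ≤ (N : ℝ) ^ ε := Real.one_le_rpow (by exact_mod_cast hN) hε.le
  have h4 : (Nat.log 2 N : ℝ) ≤ 1 / θ * (N : ℝ) ^ ε := by
    rw [div_mul_eq_mul_div, one_mul, le_div_iff₀ hθ0]
    linarith
  linarith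

lemma HasHessianOnSq.exists_eLpNorm_sum_Icc_one_le {φ p q r s t : ℝ × ℝ → ℝ}
    (H : HasHessianOnSq φ p q r s t) {ε₀ : ℝ} (hε₀ : 0 < ε₀)
    (hdet : ∀ x ∈ Sq, ε₀ ≤ |r x * t x - s x ^ 2|) (ε : ℝ) (hε : 0 < ε) : ∃ M > 0,
      ∀ N : ℕ, 0 < N → ∀ σ : ℤ, |σ| = 1 → ∀ c : ℤ → ℂ,
      eLpNorm (fun x => ∑ n ∈ Finset.Icc 1 (N : ℤ),
        c n * e ((σ * n : ℤ) * x.1 + (n : ℝ) ^ 2 * x.2 + (σ * n ^ 3 : ℤ) * φ x)) 6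
        (volume.restrict Sq) ≤ ENNReal.ofReal
        (M * (N : ℝ) ^ ε * √(∑ n ∈ Finset.Icc 1 (N : ℤ), ‖c n‖ ^ 2)) := by
  obtain ⟨M, hM, h⟩ := H.exists_eLpNorm_blockSum_le hε₀ hdet (ε / 2) (by positivity)
  obtain ⟨L, hL, hlog⟩ := exists_log_add_one_le (ε / 2) (by positivity)
  refine ⟨L * M, by positivity, fun N hN σ hσ c => ?_⟩
  have hN0 : (0 : ℝ) < N := by exact_mod_cast hN
  set S := ∑ n ∈ Finset.Icc 1 (N : ℤ), ‖c n‖ ^ 2 with hS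
  set c' : ℤ → ℂ := fun n => if n ≤ N then c n else 0 with hc'
  set m := Nat.log 2 N + 1 with hm
  have hNm : (N : ℤ) < 2 ^ m := by exact_mod_cast Nat.lt_pow_succ_log_self one_lt_two N
  have hfilter : (Finset.Ico 1 ((2 : ℤ) ^ m)).filter (fun n : ℤ => n ≤ N) = Finset.Icc 1 (N : ℤ) := by
    ext n
    simp only [Finset.mem_filter, Finset.mem_Ico, Finset.mem_Icc]
    omega
  have e1 : (fun x : ℝ × ℝ => ∑ n ∈ Finset.Icc 1 (N : ℤ),
        c n * e ((σ * n : ℤ) * x.1 + (n : ℝ) ^ 2 * x.2 + (σ * n ^ 3 : ℤ) * φ x)) =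
      ∑ k ∈ Finset.range m, blockSum φ c' σ (2 ^ k) := by
    funext x
    simp only [Finset.sum_apply, blockSum]
    rw [sum_range_sum_Ico_two_pow, ← hfilter, Finset.sum_filter]
    refine Finset.sum_congr rfl fun n _ => ?_
    simp only [hc', ite_mul, zero_mul]
  have meas : ∀ K, AEStronglyMeasurable (blockSum φ c' σ K) (volume.restrict Sq) := fun K =>
    (continuousOn_blockSum H.continuousOn c' σ K).aestronglyMeasurable isCompact_Sq.measurableSet
  have hblock : ∀ k ∈ Finset.range m, eLpNorm (blockSum φ c' σ (2 ^ k)) 6 (volume.restrict Sq) ≤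
      ENNReal.ofReal (M * (N : ℝ) ^ (ε / 2) * √S) := by
    intro k hk
    have hk' : (2 : ℕ) ^ k ≤ N :=
      (Nat.pow_le_pow_right two_pos (by rw [Finset.mem_range] at hk; omega)).trans
        (Nat.pow_log_le_self 2 hN.ne')
    have h1 : (1 : ℤ) ≤ 2 ^ k := one_le_pow₀ (by norm_num)
    refine (h (2 ^ k) σ h1 hσ c').trans (ENNReal.ofReal_le_ofReal ?_)
    have h2 : (((2 ^ k : ℤ) : ℝ)) ≤ N := by exact_mod_cast hk'
    have h3 : ∑ n ∈ Finset.Ico ((2 : ℤ) ^ k) (2 * 2 ^ k), ‖c' n‖ ^ 2 ≤ S := by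
      have : ∀ n, ‖c' n‖ ^ 2 = if n ≤ N then ‖c n‖ ^ 2 else 0 := fun n => by
        simp only [hc']; split_ifs <;> simp
      simp_rw [this]
      rw [← Finset.sum_filter]
      refine Finset.sum_le_sum_of_subset_of_nonneg (fun n hn => ?_) fun n _ _ => by positivity
      simp only [Finset.mem_filter, Finset.mem_Ico, Finset.mem_Icc] at hn ⊢
      omega
    gcongr
  rw [e1]
  refine (eLpNorm_sum_le (fun k _ => meas _) (by norm_num)).trans
    ((Finset.sum_le_sum hblock).trans ?_)
  rw [Finset.sum_const, Finset.card_range, ← ENNReal.ofReal_nsmul, nsmul_eq_mul]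
  refine ENNReal.ofReal_le_ofReal ?_
  have h5 : (m : ℝ) ≤ L * (N : ℝ) ^ (ε / 2) := by
    rw [hm]; push_cast; exact hlog N hN
  calc (m : ℝ) * (M * (N : ℝ) ^ (ε / 2) * √S)
      ≤ L * (N : ℝ) ^ (ε / 2) * (M * (N : ℝ) ^ (ε / 2) * √S) := by gcongr
    _ = L * M * ((N : ℝ) ^ (ε / 2) * (N : ℝ) ^ (ε / 2)) * √S := by ring
    _ = _ := by rw [← Real.rpow_add hN0, add_halves]

lemma sum_Icc_neg_self {R : Type*} [AddCommMonoid R] (N : ℕ) (g : ℤ → R) :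
    ∑ n ∈ Finset.Icc (-(N : ℤ)) N, g n =
      g 0 + ∑ n ∈ Finset.Icc 1 (N : ℤ), g n + ∑ n ∈ Finset.Icc 1 (N : ℤ), g (-n) := by
  have h1 : ∑ n ∈ Finset.Icc 1 (N : ℤ), g (-n) = ∑ n ∈ Finset.Icc (-(N : ℤ)) (-1), g n := by
    refine Finset.sum_nbij' (fun n => -n) (fun n => -n) ?_ ?_ ?_ ?_ ?_ <;> intro n hn <;>
      simp only [Finset.mem_Icc, neg_neg] at * <;> omega
  have h2 : Finset.Icc (-(N : ℤ)) N =
      insert 0 (Finset.Icc 1 (N : ℤ) ∪ Finset.Icc (-(N : ℤ)) (-1)) := by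
    ext n
    simp only [Finset.mem_insert, Finset.mem_union, Finset.mem_Icc]
    omega
  rw [h1, h2, Finset.sum_insert (by simp), Finset.sum_union, add_assoc]
  refine Finset.disjoint_left.2 fun n hn hn' => ?_
  simp only [Finset.mem_Icc] at hn hn'
  omega

lemma volume_restrict_Sq_univ : volume.restrict Sq Set.univ = 4 := by
  rw [Measure.restrict_apply_univ, Sq, Measure.volume_eq_prod, Measure.prod_prod, Real.volume_Icc]
  norm_num [← ENNReal.ofReal_mul]

/-- **Theorem 8 (Demeter–Langowski, moment curve).** If `φ : [-1,1]² → ℝ` is `C²` with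
nonzero Hessian determinant, then for every `ε > 0` there is `C_ε > 0` such that for every
`N ≥ 1` and all `(a_n)_{n=-N}^N`,
`‖∑ a_n e(nx + n²y + n³φ(x,y))‖_{L⁶([-1,1]²)} ≤ C_ε N^ε (∑ |a_n|²)^{1/2}`. -/
theorem stmt13 (φ : ℝ × ℝ → ℝ)
    (hφ : ContDiffOn ℝ 2 φ Sq)
    (hhess : ∃ ε > 0, ∀ p ∈ Sq,
      ε ≤ |iteratedFDerivWithin ℝ 2 φ Sq p ![(1, 0), (1, 0)] *
            iteratedFDerivWithin ℝ 2 φ Sq p ![(0, 1), (0, 1)] -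
            iteratedFDerivWithin ℝ 2 φ Sq p ![(1, 0), (0, 1)] ^ 2|) :
    ∀ ε > (0:ℝ), ∃ Cε > (0:ℝ), ∀ N : ℕ, 0 < N → ∀ a : ℤ → ℂ,
      eLpNorm (fun p : ℝ × ℝ =>
          ∑ n ∈ Finset.Icc (-(N:ℤ)) (N:ℤ),
            a n * e ((n:ℝ) * p.1 + (n:ℝ)^2 * p.2 + (n:ℝ)^3 * φ p)) 6
        (volume.restrict Sq)
      ≤ ENNReal.ofReal
          (Cε * (N:ℝ) ^ ε *
            Real.sqrt (∑ n ∈ Finset.Icc (-(N:ℤ)) (N:ℤ), ‖a n‖^2)) := by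
  intro ε hε
  obtain ⟨ε₀, hε₀, hdet⟩ := hhess
  have H := hφ.hasHessianOnSq
  obtain ⟨M, hM, h⟩ := H.exists_eLpNorm_sum_Icc_one_le hε₀ hdet ε hε
  refine ⟨4 + M + M, by positivity, fun N hN a => ?_⟩
  set S := ∑ n ∈ Finset.Icc (-(N:ℤ)) (N:ℤ), ‖a n‖ ^ 2 with hS
  have hsplit := sum_Icc_neg_self N fun n => ‖a n‖ ^ 2
  have hp : 0 ≤ ∑ n ∈ Finset.Icc 1 (N : ℤ), ‖a n‖ ^ 2 := Finset.sum_nonneg fun _ _ => by positivity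
  have hm : 0 ≤ ∑ n ∈ Finset.Icc 1 (N : ℤ), ‖a (-n)‖ ^ 2 :=
    Finset.sum_nonneg fun _ _ => by positivity
  have hpow : (1 : ℝ) ≤ (N : ℝ) ^ ε := Real.one_le_rpow (by exact_mod_cast hN) hε.le
  set f₁ : ℝ × ℝ → ℂ := fun x => ∑ n ∈ Finset.Icc 1 (N : ℤ),
    a n * e ((1 * n : ℤ) * x.1 + (n : ℝ) ^ 2 * x.2 + (1 * n ^ 3 : ℤ) * φ x) with hf₁
  set f₂ : ℝ × ℝ → ℂ := fun x => ∑ n ∈ Finset.Icc 1 (N : ℤ),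
    a (-n) * e ((-1 * n : ℤ) * x.1 + (n : ℝ) ^ 2 * x.2 + (-1 * n ^ 3 : ℤ) * φ x) with hf₂
  have hF : (fun p : ℝ × ℝ => ∑ n ∈ Finset.Icc (-(N:ℤ)) (N:ℤ),
      a n * e ((n:ℝ) * p.1 + (n:ℝ)^2 * p.2 + (n:ℝ)^3 * φ p)) =
      (fun _ => a 0) + f₁ + f₂ := by
    funext x
    simp only [sum_Icc_neg_self, Pi.add_apply, hf₁, hf₂]
    congr 1
    · congr 1
      · simp [e]
      · refine Finset.sum_congr rfl fun n _ => ?_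
        push_cast
        simp only [one_mul]
    · refine Finset.sum_congr rfl fun n _ => ?_
      congr 2
      push_cast
      ring
  have hφc := H.continuousOn
  have hc := continuous_e
  have m₁ : AEStronglyMeasurable f₁ (volume.restrict Sq) :=
    ContinuousOn.aestronglyMeasurable (by fun_prop) isCompact_Sq.measurableSet
  have m₂ : AEStronglyMeasurable f₂ (volume.restrict Sq) :=
    ContinuousOn.aestronglyMeasurable (by fun_prop) isCompact_Sq.measurableSet
  have b₀ : eLpNorm (fun _ : ℝ × ℝ => a 0) 6 (volume.restrict Sq) ≤
      ENNReal.ofReal (4 * (N : ℝ) ^ ε * √S) := by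
    rw [eLpNorm_const' _ (by norm_num) (by norm_num), volume_restrict_Sq_univ]
    have h1 : (4 : ENNReal) ^ (1 / (6 : ENNReal).toReal) ≤ 4 := by
      nth_rw 2 [← ENNReal.rpow_one 4]
      exact ENNReal.rpow_le_rpow_of_exponent_le (by norm_num) (by norm_num)
    have h2 : ‖a 0‖ ≤ √S := Real.le_sqrt_of_sq_le (by linarith)
    calc ‖a 0‖ₑ * 4 ^ (1 / (6 : ENNReal).toReal) ≤ ‖a 0‖ₑ * 4 := by gcongr
      _ = ENNReal.ofReal (4 * 1 * ‖a 0‖) := by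
        rw [mul_one, ENNReal.ofReal_mul (by norm_num), ofReal_norm, mul_comm]
        norm_num
      _ ≤ _ := ENNReal.ofReal_le_ofReal (by gcongr)
  have b₁ : eLpNorm f₁ 6 (volume.restrict Sq) ≤ ENNReal.ofReal (M * (N : ℝ) ^ ε * √S) :=
    (h N hN 1 (by norm_num) a).trans (ENNReal.ofReal_le_ofReal (by
      gcongr
      linarith [sq_nonneg ‖a 0‖]))
  have b₂ : eLpNorm f₂ 6 (volume.restrict Sq) ≤ ENNReal.ofReal (M * (N : ℝ) ^ ε * √S) :=
    (h N hN (-1) (by norm_num) fun n => a (-n)).trans (ENNReal.ofReal_le_ofReal (by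
      gcongr
      linarith [sq_nonneg ‖a 0‖]))
  rw [hF, add_mul, add_mul, add_mul, add_mul, ENNReal.ofReal_add (by positivity) (by positivity),
    ENNReal.ofReal_add (by positivity) (by positivity)]
  refine (eLpNorm_add_le (aestronglyMeasurable_const.add m₁) m₂ (by norm_num)).trans ?_
  exact add_le_add ((eLpNorm_add_le aestronglyMeasurable_const m₁ (by norm_num)).trans
    (add_le_add b₀ b₁)) b₂
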